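/- arXiv:1710.02440 — 2 statements merged into one kernel-verified Lean document; each statement's English description precedes it below -/
import Mathlib

section
/- Let n > 2k ≥ 8. Let F be an intersecting family of k-element subsets of [n] with Δ(F) = δ(1). Suppose there exist sets A, B ∈ F(1̄) := {F ∈ F : 1 ∉ F} with |A∩B| = k−s+1 for some s ∈ {2,…,k}, and suppose that k−s+1 ≥ 4 or γ(F) ≤ C(n−5,k−4). Then |F| ≤ |J_s|, with equality only if F is isomorphic to J_s. -/
open Finset

def IntersectingFam (F : Finset (Finset ℕ)) : Prop :=
  ∀ A ∈ F, ∀ B ∈ F, (A ∩ B).Nonempty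

def CrossIntersecting (𝒜 ℬ : Finset (Finset ℕ)) : Prop :=
  ∀ A ∈ 𝒜, ∀ B ∈ ℬ, (A ∩ B).Nonempty

/-- The degree of an element `i`: the number of sets of `F` containing `i`. -/
def famDeg (F : Finset (Finset ℕ)) (i : ℕ) : ℕ := (F.filter (fun A => i ∈ A)).card

/-- The maximal degree `Δ(F)` over the ground set `[n]`. -/
def maxDeg (n : ℕ) (F : Finset (Finset ℕ)) : ℕ := (Finset.Icc 1 n).sup (famDeg F)

/-- The diversity `γ(F) = |F| − Δ(F)`. -/
def diversity (n : ℕ) (F : Finset (Finset ℕ)) : ℕ := F.card - maxDeg n F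

/-- The degree of a subset `S`: the number of sets of `F` containing `S`. -/
def tDeg (F : Finset (Finset ℕ)) (S : Finset ℕ) : ℕ := (F.filter (fun A => S ⊆ A)).card

/-- Lexicographic order: `A ⪯ B` iff `A ⊇ B` or `min (A \ B) < min (B \ A)`. -/
def lexLE (A B : Finset ℕ) : Prop := B ⊆ A ∨ (A \ B).min < (B \ A).min

instance : DecidableRel lexLE := fun A B => by unfold lexLE; exact inferInstance

def lexLT (A B : Finset ℕ) : Prop := lexLE A B ∧ A ≠ B

/-- Lex family with characteristic set `X` on ground set `[2,n]`:
`L(X,a) = {A ⊆ [2,n] : |A| = a, A ⪯ X ∩ [2,n]}`. -/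
def lexFam (n a : ℕ) (X : Finset ℕ) : Finset (Finset ℕ) :=
  ((Finset.Icc 2 n).powersetCard a).filter (fun A => lexLE A (X ∩ Finset.Icc 2 n))

/-- Lex family with characteristic set `X` on ground set `[n]`:
`L(X,c) = {A ⊆ [n] : |A| = c, A ⪯ X}`. -/
def lexFam1 (n c : ℕ) (X : Finset ℕ) : Finset (Finset ℕ) :=
  ((Finset.Icc 1 n).powersetCard c).filter (fun A => lexLE A X)

/-- Resistant pairs for uniformity `k` on ground set `[n]`. -/
def ResistantPair (n k : ℕ) (S T : Finset ℕ) : Prop :=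
  (S = ({1, 4} : Finset ℕ) ∧ T = ({2, 3, 4} : Finset ℕ)) ∨
  (1 ∈ S ∧ S ⊆ Finset.Icc 1 n ∧ T ⊆ Finset.Icc 2 n ∧
    ∃ j : ℕ, T.max = (j : WithTop ℕ) ∧ S ∩ T = {j} ∧ S ∪ T = Finset.Icc 1 j ∧
      S.card ≤ k ∧ T.card ≤ k ∧
      ∀ i : ℕ, 4 ≤ i → i ≤ j → (Finset.Icc 1 i ∩ S).card < (Finset.Icc 1 i \ S).card)

/-- `(a,b)`-resistant pairs on ground set `[n]`. -/
def ABResistantPair (n a b : ℕ) (S T : Finset ℕ) : Prop :=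
  (T = Finset.Icc 1 (b - a + 2) ∧ S = ({1, b - a + 2} : Finset ℕ)) ∨
  (S ⊆ Finset.Icc 1 n ∧ T ⊆ Finset.Icc 1 n ∧
    ∃ j : ℕ, T.max = (j : WithTop ℕ) ∧ S ∩ T = {j} ∧ S ∪ T = Finset.Icc 1 j ∧
      S.card ≤ a ∧ T.card ≤ b ∧
      ∀ i : ℕ, b - a + 2 ≤ i → i ≤ j →
        ((Finset.Icc 1 i ∩ S).card : ℤ) - (a : ℤ) < ((Finset.Icc 1 i \ S).card : ℤ) - (b : ℤ))

/-- Resistant numbers: `γ` is resistant if in its `(n−k−1)`-cascade form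
`γ = Σ_{i=1}^s C(n−b_i, n−k−i)` (with `1 ≤ b_1 < … < b_s`) one has `|S_γ| ≤ k`,
`s ≤ k−1` and `b_i > 2i+2` for each `i`; in addition `C(n−4,k−3)` is resistant. -/
def IsResistantNum (n k γ : ℕ) : Prop :=
  γ = Nat.choose (n - 4) (k - 3) ∨
  ∃ (s : ℕ) (b : ℕ → ℕ), 1 ≤ s ∧ 1 ≤ b 1 ∧
    (∀ i j, 1 ≤ i → i < j → j ≤ s → b i < b j) ∧
    γ = ∑ i ∈ Finset.Icc 1 s, Nat.choose (n - b i) (n - k - i) ∧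
    s ≤ k - 1 ∧
    (insert (b s) (Finset.Icc 2 (b s) \ (Finset.Icc 1 s).image b)).card ≤ k ∧
    (∀ i, 1 ≤ i → i ≤ s → b i > 2 * i + 2)

/-- The family `J_i`. -/
def Jfam (n k i : ℕ) : Finset (Finset ℕ) :=
  {Finset.Icc 2 (k+1), Finset.Icc (i+1) (k+i)} ∪
    ((Finset.Icc 1 n).powersetCard k).filter
      (fun F => 1 ∈ F ∧ (F ∩ Finset.Icc 2 (k+1)).Nonempty ∧ (F ∩ Finset.Icc (i+1) (k+i)).Nonempty)

/-- Two families are isomorphic if one is obtained from the other by a permutation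
of the ground set `[n]`. -/
def IsomorphicFam (n : ℕ) (F G : Finset (Finset ℕ)) : Prop :=
  ∃ σ : Equiv.Perm ℕ, (Finset.Icc 1 n).image σ = Finset.Icc 1 n ∧
    F.image (fun A => A.image σ) = G

/-- `F` is isomorphic to a subfamily of `G`. -/
def IsoSubfamily (n : ℕ) (F G : Finset (Finset ℕ)) : Prop :=
  ∃ σ : Equiv.Perm ℕ, (Finset.Icc 1 n).image σ = Finset.Icc 1 n ∧
    F.image (fun A => A.image σ) ⊆ G

/-- `L` is an initial segment of the lex order on `k`-subsets of `[2,n]`. -/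
def IsInitialSeg (n k : ℕ) (L : Finset (Finset ℕ)) : Prop :=
  L ⊆ (Finset.Icc 2 n).powersetCard k ∧
  ∀ A ∈ L, ∀ B ∈ (Finset.Icc 2 n).powersetCard k, lexLE B A → B ∈ L

/-- The maximal intersecting family `F_l` whose sets avoiding `1` are exactly `L`. -/
def maxFam (n k : ℕ) (L : Finset (Finset ℕ)) : Finset (Finset ℕ) :=
  L ∪ ((Finset.Icc 1 n).powersetCard k).filter
    (fun A => 1 ∈ A ∧ ∀ B ∈ L, (A ∩ B).Nonempty)

/-- The sets `T` allowed in the recursive definition of a `T_l`-neutral pair: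
`T_l` is allowed, and whenever `T'` is allowed so is `T' ∪ {2|T'|}`. -/
inductive NeutralSet (T0 : Finset ℕ) : Finset ℕ → Prop
  | base : NeutralSet T0 T0
  | step (T' : Finset ℕ) : NeutralSet T0 T' → NeutralSet T0 (insert (2 * T'.card) T')

/-- The family `A_0(n,k,s)`. -/
def A0fam (n k s : ℕ) : Finset (Finset ℕ) :=
  ((Finset.Icc 1 n).powersetCard k).filter (fun A => (A ∩ Finset.Icc 1 s).Nonempty)

/-- The `q`-subsets of `Y` disjoint from some member of `𝒟`. -/
def nbr (Y : Finset ℕ) (q : ℕ) (𝒟 : Finset (Finset ℕ)) : Finset (Finset ℕ) :=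
  (Y.powersetCard q).filter (fun E => ∃ D ∈ 𝒟, Disjoint D E)

/-- The `q`-element subsets of members of `𝒜`. -/
def lowerShadow (q : ℕ) (𝒜 : Finset (Finset ℕ)) : Finset (Finset ℕ) :=
  𝒜.biUnion (powersetCard q)

lemma mem_nbr {Y : Finset ℕ} {q : ℕ} {𝒟 : Finset (Finset ℕ)} {E : Finset ℕ} :
    E ∈ nbr Y q 𝒟 ↔ (E ⊆ Y ∧ E.card = q) ∧ ∃ D ∈ 𝒟, Disjoint D E := by
  simp [nbr, mem_powersetCard]

lemma mem_lowerShadow {q : ℕ} {𝒜 : Finset (Finset ℕ)} {E : Finset ℕ} :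
    E ∈ lowerShadow q 𝒜 ↔ ∃ D ∈ 𝒜, E ⊆ D ∧ E.card = q := by
  simp [lowerShadow, mem_powersetCard]

lemma nbr_mono {Y : Finset ℕ} {q : ℕ} {𝒟 𝒟' : Finset (Finset ℕ)} (h : 𝒟 ⊆ 𝒟') :
    nbr Y q 𝒟 ⊆ nbr Y q 𝒟' := by
  intro E hE
  rw [mem_nbr] at hE ⊢
  obtain ⟨h1, D, hD, h2⟩ := hE
  exact ⟨h1, D, h hD, h2⟩

lemma exists_isInitSeg_card (M c g : ℕ) (hg : g ≤ M.choose c) :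
    ∃ 𝒞 : Finset (Finset (Fin M)), Colex.IsInitSeg 𝒞 c ∧ 𝒞.card = g := by
  induction g with
  | zero => exact ⟨∅, by simp, rfl⟩
  | succ g ih =>
    obtain ⟨𝒞, h𝒞, hcard⟩ := ih (by omega)
    have hne : (((univ : Finset (Fin M)).powersetCard c) \ 𝒞).Nonempty := by
      rw [← card_pos]
      have := le_card_sdiff 𝒞 ((univ : Finset (Fin M)).powersetCard c)
      rw [card_powersetCard, card_univ, Fintype.card_fin] at this
      omega
    obtain ⟨s, hs, hmin⟩ := exists_min_image _ toColex hne
    rw [mem_sdiff, mem_powersetCard_univ] at hs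
    refine ⟨insert s 𝒞, ⟨?_, ?_⟩, by rw [card_insert_of_notMem hs.2, hcard]⟩
    · intro t ht
      rcases mem_insert.1 ht with rfl | ht
      · exact hs.1
      · exact h𝒞.1 ht
    · intro t u ht hu
      rcases mem_insert.1 ht with rfl | ht
      · by_contra hu'
        have hu'' : u ∉ 𝒞 := fun h => hu' (mem_insert_of_mem h)
        exact absurd (hmin u (by simp [hu.2, hu''])) (not_le.2 hu.1)
      · exact mem_insert_of_mem (h𝒞.2 ht hu)

lemma isInitSeg_powersetCard_lt (M N c : ℕ) :
    Colex.IsInitSeg ((univ.filter (fun i : Fin M => (i : ℕ) < N)).powersetCard c) c := by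
  refine ⟨fun t ht => (mem_powersetCard.1 ht).2, fun s t hs ht => ?_⟩
  rw [mem_powersetCard] at hs ⊢
  refine ⟨fun x hx => ?_, ht.2⟩
  simp only [mem_filter, mem_univ, true_and]
  by_contra hxN
  have hall : ∀ b ∈ s, b < x := fun b hb => by
    have := (mem_filter.1 (hs.1 hb)).2
    rw [Fin.lt_def]; omega
  exact lt_irrefl _ (Colex.forall_lt_mono ht.1.le hall x hx)

/-- Kruskal–Katona for disjointness neighbourhoods: passing to complements and compressing. -/
lemma exists_compressed {Y : Finset ℕ} {p c q : ℕ} {𝒟 : Finset (Finset ℕ)}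
    (hY : Y.card = p + c) (h𝒟 : 𝒟 ⊆ Y.powersetCard p) (hq : q ≤ c) :
    ∃ 𝒜 : Finset (Finset ℕ), 𝒜.card = 𝒟.card ∧
      (lowerShadow q 𝒜).card ≤ (nbr Y q 𝒟).card ∧ 𝒜 ⊆ (range (p + c)).powersetCard c ∧
      (∀ N ≤ p + c, N.choose c ≤ 𝒟.card → (range N).powersetCard c ⊆ 𝒜) ∧
      (∀ N ≤ p + c, 𝒟.card ≤ N.choose c → 𝒜 ⊆ (range N).powersetCard c) := by
  classical
  set M := p + c with hM
  have e : Y ≃ Fin M := Y.equivFinOfCardEq hY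
  set φ : Finset ℕ → Finset (Fin M) := fun D => univ.filter (fun i => (e.symm i : ℕ) ∉ D) with hφ
  set ψ : Fin M ↪ ℕ := e.symm.toEmbedding.trans (Function.Embedding.subtype _) with hψ
  have hψval : ∀ i, ψ i = (e.symm i : ℕ) := fun i => rfl
  have hφmap : ∀ D ⊆ Y, (φ D).map ψ = Y \ D := by
    intro D hD
    ext x
    simp only [mem_map, mem_sdiff, hφ, mem_filter, mem_univ, true_and, hψval]
    constructor
    · rintro ⟨i, hi, rfl⟩
      exact ⟨(e.symm i).2, hi⟩
    · rintro ⟨hx, hxD⟩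
      exact ⟨e ⟨x, hx⟩, by simpa using hxD, by simp⟩
  have hDY : ∀ D ∈ 𝒟, D ⊆ Y ∧ D.card = p := fun D hD => mem_powersetCard.1 (h𝒟 hD)
  have hφcard : ∀ D ∈ 𝒟, (φ D).card = c := by
    intro D hD
    rw [← card_map ψ, hφmap D (hDY D hD).1, card_sdiff_of_subset (hDY D hD).1, (hDY D hD).2, hY]
    omega
  set 𝒟' := 𝒟.image φ with h𝒟'
  have hinj : Set.InjOn φ 𝒟 := by
    intro D hD D' hD' h
    have : Y \ D = Y \ D' := by
      rw [← hφmap D (hDY D hD).1, ← hφmap D' (hDY D' hD').1, h]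
    rw [← Finset.sdiff_sdiff_eq_self (hDY D hD).1, this, Finset.sdiff_sdiff_eq_self (hDY D' hD').1]
  have hcard' : 𝒟'.card = 𝒟.card := card_image_of_injOn hinj
  have hsized : (𝒟' : Set (Finset (Fin M))).Sized c := by
    intro s hs
    obtain ⟨D, hD, rfl⟩ := mem_image.1 (mem_coe.1 hs)
    exact hφcard D hD
  have hle : 𝒟.card ≤ M.choose c := by
    have := card_le_card h𝒟
    rw [card_powersetCard, hY] at this
    rwa [hM, ← Nat.choose_symm_add]
  obtain ⟨𝒞, h𝒞, h𝒞card⟩ := exists_isInitSeg_card M c 𝒟.card hle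
  have hkk := iterated_kk (k := c - q) hsized (by rw [h𝒞card, hcard']) h𝒞
  set v : Finset (Fin M) ↪ Finset ℕ := mapEmbedding Fin.valEmbedding |>.toEmbedding with hv
  have hvv : ∀ s, v s = s.map Fin.valEmbedding := fun s => rfl
  have hcardN : ∀ N ≤ M, ((univ.filter (fun i : Fin M => (i : ℕ) < N)).map
      Fin.valEmbedding) = range N := by
    intro N hN
    ext x
    simp only [mem_map, mem_filter, mem_univ, true_and, Fin.valEmbedding_apply, mem_range]
    constructor
    · rintro ⟨i, hi, rfl⟩; exact hi
    · intro hx; exact ⟨⟨x, by omega⟩, hx, rfl⟩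
  have hmapN : ∀ N ≤ M, (((univ.filter (fun i : Fin M => (i : ℕ) < N)).powersetCard
      c).map v) = (range N).powersetCard c := by
    intro N hN
    rw [← hcardN N hN, powersetCard_map]
  have hcardN' : ∀ N ≤ M, ((univ.filter (fun i : Fin M => (i : ℕ) < N)).powersetCard
      c).card = N.choose c := by
    intro N hN
    rw [← card_map v, hmapN N hN, card_powersetCard, card_range]
  refine ⟨𝒞.map v, by rw [card_map, h𝒞card], ?_, ?_, ?_, ?_⟩
  · have h1 : lowerShadow q (𝒞.map v) ⊆ (shadow^[c - q] 𝒞).map v := by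
      intro E hE
      rw [mem_lowerShadow] at hE
      obtain ⟨D, hD, hED, hEq⟩ := hE
      obtain ⟨s, hs, rfl⟩ := mem_map.1 hD
      rw [hvv] at hED
      obtain ⟨u, hu, rfl⟩ := subset_map_iff.1 hED
      refine mem_map.2 ⟨u, ?_, rfl⟩
      rw [mem_shadow_iterate_iff_exists_mem_card_add]
      refine ⟨s, hs, hu, ?_⟩
      rw [card_map] at hEq
      rw [h𝒞.1 hs]
      omega
    have h2 : (shadow^[c - q] 𝒟').map (mapEmbedding ψ).toEmbedding ⊆ nbr Y q 𝒟 := by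
      intro E hE
      obtain ⟨s, hs, rfl⟩ := mem_map.1 hE
      rw [mem_shadow_iterate_iff_exists_mem_card_add] at hs
      obtain ⟨u, hu, hsu, hc⟩ := hs
      obtain ⟨D, hD, rfl⟩ := mem_image.1 hu
      rw [hφcard D hD] at hc
      have hsub : s.map ψ ⊆ Y \ D := by
        rw [← hφmap D (hDY D hD).1]
        exact map_subset_map.2 hsu
      rw [mem_nbr]
      refine ⟨⟨hsub.trans sdiff_subset, ?_⟩, D, hD, ?_⟩
      · simp only [RelEmbedding.coe_toEmbedding, mapEmbedding_apply, card_map]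
        omega
      · exact (disjoint_sdiff).mono_right hsub
    calc _ ≤ _ := card_le_card h1
      _ = _ := card_map _
      _ ≤ _ := hkk
      _ = _ := (card_map _).symm
      _ ≤ _ := card_le_card h2
  · rw [← hmapN M le_rfl]
    refine map_subset_map.2 fun s hs => mem_powersetCard.2 ⟨fun i _ => by simp, h𝒞.1 hs⟩
  · intro N hN h
    rw [← hmapN N hN]
    refine map_subset_map.2 ?_
    rcases (isInitSeg_powersetCard_lt M N c).total h𝒞 with hle | hle
    · exact hle
    · exact (eq_of_subset_of_card_le hle (by rw [hcardN' N hN, h𝒞card]; exact h)).ge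
  · intro N hN h
    rw [← hmapN N hN]
    refine map_subset_map.2 ?_
    rcases (isInitSeg_powersetCard_lt M N c).total h𝒞 with hle | hle
    · exact (eq_of_subset_of_card_le hle (by rw [hcardN' N hN, h𝒞card]; exact h)).ge
    · exact hle

/-- The local LYM inequality for iterated shadows. -/
lemma card_mul_choose_le_card_lowerShadow_mul {Z : Finset ℕ} {N c q : ℕ}
    {𝒜 : Finset (Finset ℕ)} (hZ : Z.card = N) (h𝒜 : 𝒜 ⊆ Z.powersetCard c) (hq : q ≤ c) :
    𝒜.card * N.choose q ≤ (lowerShadow q 𝒜).card * N.choose c := by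
  rcases 𝒜.eq_empty_or_nonempty with rfl | ⟨D₀, hD₀⟩
  · simp
  have hcN : c ≤ N := by
    have := mem_powersetCard.1 (h𝒜 hD₀)
    rw [← this.2, ← hZ]
    exact card_le_card this.1
  have key : 𝒜.card * c.choose q ≤ (lowerShadow q 𝒜).card * (N - q).choose (c - q) := by
    refine card_mul_le_card_mul (fun D E => E ⊆ D) ?_ ?_
    · intro D hD
      have hDc := (mem_powersetCard.1 (h𝒜 hD)).2
      rw [← hDc, ← card_powersetCard]
      refine card_le_card fun E hE => ?_
      rw [mem_powersetCard] at hE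
      simp only [bipartiteAbove, mem_filter, mem_lowerShadow]
      exact ⟨⟨D, hD, hE⟩, hE.1⟩
    · intro E hE
      obtain ⟨D₁, hD₁, hED₁, hEq⟩ := mem_lowerShadow.1 hE
      have hEZ : E ⊆ Z := hED₁.trans (mem_powersetCard.1 (h𝒜 hD₁)).1
      have hc : (Z \ E).card = N - q := by rw [card_sdiff_of_subset hEZ, hZ, hEq]
      rw [← hc, ← card_powersetCard]
      refine card_le_card_of_injOn (fun D => D \ E) ?_ ?_
      · intro D hD
        replace hD := mem_filter.1 (mem_coe.1 hD)
        have := mem_powersetCard.1 (h𝒜 hD.1)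
        rw [mem_coe, mem_powersetCard]
        refine ⟨sdiff_subset_sdiff this.1 subset_rfl, ?_⟩
        rw [card_sdiff_of_subset hD.2, this.2, hEq]
      · intro D hD D' hD' h
        replace hD := mem_filter.1 (mem_coe.1 hD)
        replace hD' := mem_filter.1 (mem_coe.1 hD')
        rw [← sdiff_union_of_subset hD.2, ← sdiff_union_of_subset hD'.2]
        exact congrArg (· ∪ E) h
  have hpos : 0 < c.choose q := Nat.choose_pos hq
  refine Nat.le_of_mul_le_mul_right ?_ hpos
  calc 𝒜.card * N.choose q * c.choose q = 𝒜.card * c.choose q * N.choose q := by ring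
    _ ≤ (lowerShadow q 𝒜).card * (N - q).choose (c - q) * N.choose q :=
        Nat.mul_le_mul_right _ key
    _ = (lowerShadow q 𝒜).card * (N.choose q * (N - q).choose (c - q)) := by ring
    _ = (lowerShadow q 𝒜).card * (N.choose c * c.choose q) := by rw [Nat.choose_mul hq]
    _ = _ := by ring

lemma powersetCard_subset_lowerShadow {N c q : ℕ} {𝒜 : Finset (Finset ℕ)}
    (h : (range N).powersetCard c ⊆ 𝒜) (hcN : c ≤ N) (hq : q ≤ c) :
    (range N).powersetCard q ⊆ lowerShadow q 𝒜 := by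
  intro E hE
  rw [mem_powersetCard] at hE
  obtain ⟨D, hED, hDN, hD⟩ := exists_subsuperset_card_eq hE.1 (by omega : E.card ≤ c)
    (by rw [card_range]; exact hcN)
  exact mem_lowerShadow.2 ⟨D, h (mem_powersetCard.2 ⟨hDN, hD⟩), hED, hE.2⟩

lemma card_le_choose_of_nbr {Y : Finset ℕ} {p c q N : ℕ} {𝒟 : Finset (Finset ℕ)}
    (hY : Y.card = p + c) (h𝒟 : 𝒟 ⊆ Y.powersetCard p) (hq : q ≤ c) (hN : N ≤ p + c)
    (hle : 𝒟.card ≤ N.choose c) :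
    𝒟.card * N.choose q ≤ (nbr Y q 𝒟).card * N.choose c := by
  obtain ⟨𝒜, h1, h2, -, -, h5⟩ := exists_compressed hY h𝒟 hq
  have := card_mul_choose_le_card_lowerShadow_mul (card_range N) (h5 N hN hle) hq
  rw [h1] at this
  exact this.trans (Nat.mul_le_mul_right _ h2)

lemma choose_le_card_nbr {Y : Finset ℕ} {p c q N : ℕ} {𝒟 : Finset (Finset ℕ)}
    (hY : Y.card = p + c) (h𝒟 : 𝒟 ⊆ Y.powersetCard p) (hq : q ≤ c) (hN : N ≤ p + c) (hcN : c ≤ N)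
    (hle : N.choose c ≤ 𝒟.card) : N.choose q ≤ (nbr Y q 𝒟).card := by
  obtain ⟨𝒜, h1, h2, -, h4, -⟩ := exists_compressed hY h𝒟 hq
  have := card_le_card (powersetCard_subset_lowerShadow (h4 N hN hle) hcN hq)
  rw [card_powersetCard, card_range] at this
  exact this.trans h2

/-- Splitting a family between two consecutive full levels by its top element. -/
lemma exists_split_top {N c q : ℕ} {𝒜 : Finset (Finset ℕ)} (hcN : c + 1 ≤ N) (hq : q ≤ c)
    (hfull : (range N).powersetCard (c + 1) ⊆ 𝒜)
    (hsub : 𝒜 ⊆ (range (N + 1)).powersetCard (c + 1)) :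
    ∃ 𝒜' ⊆ (range N).powersetCard c, 𝒜.card = N.choose (c + 1) + 𝒜'.card ∧
      N.choose (q + 1) + (lowerShadow q 𝒜').card ≤ (lowerShadow (q + 1) 𝒜).card := by
  refine ⟨𝒜.memberSubfamily N, ?_, ?_, ?_⟩
  · intro E hE
    rw [mem_memberSubfamily] at hE
    have := mem_powersetCard.1 (hsub hE.1)
    rw [card_insert_of_notMem hE.2] at this
    refine mem_powersetCard.2 ⟨fun x hx => ?_, by omega⟩
    have hx' := mem_range.1 (this.1 (mem_insert_of_mem hx))
    have : x ≠ N := fun h => hE.2 (h ▸ hx)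
    exact mem_range.2 (by omega)
  · rw [← card_memberSubfamily_add_card_nonMemberSubfamily N 𝒜, add_comm]
    congr 1
    have : 𝒜.nonMemberSubfamily N = (range N).powersetCard (c + 1) := by
      ext E
      rw [mem_nonMemberSubfamily]
      constructor
      · rintro ⟨hE, hN⟩
        have := mem_powersetCard.1 (hsub hE)
        refine mem_powersetCard.2 ⟨fun x hx => ?_, this.2⟩
        have hx' := mem_range.1 (this.1 hx)
        have : x ≠ N := fun h => hN (h ▸ hx)
        exact mem_range.2 (by omega)
      · intro hE
        exact ⟨hfull hE, fun h => by simpa using (mem_powersetCard.1 hE).1 h⟩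
    rw [this, card_powersetCard, card_range]
  · have h1 := powersetCard_subset_lowerShadow hfull hcN (by omega : q + 1 ≤ c + 1)
    have hN : ∀ E ∈ lowerShadow q (𝒜.memberSubfamily N), N ∉ E := by
      intro E hE
      obtain ⟨D, hD, hED, -⟩ := mem_lowerShadow.1 hE
      exact fun h => (mem_memberSubfamily.1 hD).2 (hED h)
    have h2 : ((lowerShadow q (𝒜.memberSubfamily N)).image (insert N)) ⊆
        lowerShadow (q + 1) 𝒜 := by
      intro E' hE'
      obtain ⟨E, hE, rfl⟩ := mem_image.1 hE'
      have hNE := hN E hE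
      obtain ⟨D, hD, hED, hEq⟩ := mem_lowerShadow.1 hE
      exact mem_lowerShadow.2 ⟨insert N D, (mem_memberSubfamily.1 hD).1,
        insert_subset_insert _ hED, by rw [card_insert_of_notMem hNE, hEq]⟩
    have h3 : ((lowerShadow q (𝒜.memberSubfamily N)).image (insert N)).card =
        (lowerShadow q (𝒜.memberSubfamily N)).card := by
      refine card_image_of_injOn fun E hE E' hE' h => ?_
      rw [← erase_insert (hN E hE), ← erase_insert (hN E' hE')]
      exact congrArg (fun s => s.erase N) h
    have h4 : Disjoint ((range N).powersetCard (q + 1))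
        ((lowerShadow q (𝒜.memberSubfamily N)).image (insert N)) := by
      rw [disjoint_left]
      intro E hE hE'
      obtain ⟨E'', -, rfl⟩ := mem_image.1 hE'
      simpa using (mem_powersetCard.1 hE).1 (mem_insert_self _ _)
    have h5 := card_le_card (union_subset h1 h2)
    rwa [card_union_of_disjoint h4, h3, card_powersetCard, card_range] at h5

lemma choose_lt_choose_of_add_lt {M a b : ℕ} (hab : a < b) (h : a + b < M) :
    M.choose a < M.choose b := by
  have h1 := Nat.choose_mul (n := M) (k := b) (s := a) hab.le
  have h2 : b.choose a < (M - a).choose (b - a) := by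
    rw [← Nat.choose_symm hab.le]
    calc b.choose (b - a) < (b + 1).choose (b - a) := by
          obtain ⟨d, hd⟩ : ∃ d, b - a = d + 1 := ⟨b - a - 1, by omega⟩
          rw [hd, Nat.choose_succ_succ']
          have : 0 < b.choose d := Nat.choose_pos (by omega)
          omega
      _ ≤ _ := Nat.choose_le_choose _ (by omega)
  have h3 : 0 < M.choose a := Nat.choose_pos (by omega)
  have h4 : 0 < b.choose a := Nat.choose_pos hab.le
  by_contra hle
  push Not at hle
  have : M.choose b * b.choose a < M.choose b * b.choose a := by
    calc M.choose b * b.choose a ≤ M.choose a * b.choose a := Nat.mul_le_mul_right _ hle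
      _ < M.choose a * (M - a).choose (b - a) := Nat.mul_lt_mul_of_pos_left h2 h3
      _ = _ := h1.symm
  exact lt_irrefl _ this

lemma choose_le_choose_of_add_le {M a b : ℕ} (hab : a ≤ b) (h : a + b ≤ M) :
    M.choose a ≤ M.choose b := by
  rcases hab.eq_or_lt with rfl | hab
  · rfl
  rcases h.eq_or_lt with h | h
  · rw [← Nat.choose_symm_of_eq_add h.symm]
  · exact (choose_lt_choose_of_add_lt hab h).le

lemma card_lt_card_nbr {Y : Finset ℕ} {p c q : ℕ} {𝒟 : Finset (Finset ℕ)}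
    (hY : Y.card = p + c) (h𝒟 : 𝒟 ⊆ Y.powersetCard p) (hq : q < c) (hpos : 0 < 𝒟.card)
    (hlt : 𝒟.card < (c + q).choose q) : 𝒟.card < (nbr Y q 𝒟).card := by
  have key : ∀ N ≤ p + c, 𝒟.card ≤ N.choose c → N.choose c < N.choose q →
      𝒟.card < (nbr Y q 𝒟).card := by
    intro N hN h1 h2
    have h3 := card_le_choose_of_nbr hY h𝒟 hq.le hN h1
    by_contra hle
    push Not at hle
    have := Nat.mul_le_mul_right (N.choose c) hle
    have := Nat.mul_lt_mul_of_pos_left h2 hpos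
    omega
  by_cases hpq : p < q
  · refine key (p + c) le_rfl ?_ ?_
    · have := card_le_card h𝒟
      rw [card_powersetCard, hY] at this
      rwa [← Nat.choose_symm_add]
    · rw [← Nat.choose_symm_add]
      exact choose_lt_choose_of_add_lt hpq (by omega)
  obtain _ | q := q
  · rw [Nat.choose_zero_right] at hlt
    omega
  obtain _ | c := c
  · omega
  have e1 : (c + 1 + q).choose (c + 1) = (c + 1 + q).choose q := Nat.choose_symm_add
  have e2 : (c + 1 + q).choose c = (c + 1 + q).choose (q + 1) :=
    Nat.choose_symm_of_eq_add (by omega)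
  have huv : (c + 1 + q).choose q < (c + 1 + q).choose (q + 1) :=
    choose_lt_choose_of_add_lt (by omega) (by omega)
  by_cases hle : 𝒟.card ≤ (c + 1 + q).choose (c + 1)
  · exact key (c + 1 + q) (by omega) hle (by omega)
  push Not at hle
  obtain ⟨𝒜, h1, h2, -, h4, h5⟩ := exists_compressed hY h𝒟 hq.le
  have e3 : (c + 1 + (q + 1)).choose (q + 1) =
      (c + 1 + q).choose q + (c + 1 + q).choose (q + 1) := Nat.choose_succ_succ _ _
  have e4 : (c + 1 + q + 1).choose (c + 1) =
      (c + 1 + q).choose c + (c + 1 + q).choose (c + 1) := Nat.choose_succ_succ _ _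
  obtain ⟨𝒜', hA1, hA2, hA3⟩ := exists_split_top (q := q) (by omega) (by omega)
    (h4 (c + 1 + q) (by omega) hle.le) (h5 (c + 1 + q + 1) (by omega) (by omega))
  have hA4 := card_mul_choose_le_card_lowerShadow_mul (card_range _) hA1 (by omega : q ≤ c)
  rw [e2] at hA4
  set u := (c + 1 + q).choose q
  set v := (c + 1 + q).choose (q + 1)
  set a := 𝒜'.card
  set b := (lowerShadow q 𝒜').card
  have ha : a < v := by omega
  suffices u + a < v + b by omega
  by_contra hcon
  push Not at hcon
  obtain ⟨w, hw⟩ : ∃ w, v = u + w := ⟨v - u, by omega⟩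
  have hw0 : 0 < w := by omega
  have hw1 := Nat.mul_lt_mul_of_pos_left ha hw0
  have hw2 := Nat.mul_le_mul_left v (show w + b ≤ a by omega)
  have hw3 : a * v = a * u + a * w := by rw [hw, mul_add]
  linarith [mul_add v w b]

/-- A family whose size lies between two cascade levels has a neighbourhood larger than itself
by the excess of the lower level. -/
lemma card_add_choose_le_card_nbr {Y : Finset ℕ} {m k p : ℕ} {𝒟 : Finset (Finset ℕ)}
    (hk : 4 ≤ k) (hm : 2 * k ≤ m) (hY : Y.card = p + (m - k)) (hp : k ≤ p + 2)
    (h𝒟 : 𝒟 ⊆ Y.powersetCard p)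
    (hlow : (m - 4).choose (k - 4) ≤ 𝒟.card) (hup : 𝒟.card ≤ (m - 2).choose (k - 2)) :
    𝒟.card + (m - 4).choose (k - 1) ≤ (nbr Y (k - 1) 𝒟).card + (m - 4).choose (k - 4) := by
  obtain ⟨r, rfl⟩ : ∃ r, k = r + 4 := ⟨k - 4, by omega⟩
  obtain ⟨c, rfl⟩ : ∃ c, m = r + 4 + (c + 1) := ⟨m - r - 5, by omega⟩
  have i1 : r + 4 + (c + 1) - 4 = r + (c + 1) := by omega
  have i2 : r + 4 + (c + 1) - 2 = r + (c + 1) + 2 := by omega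
  simp only [i1, i2, Nat.add_sub_cancel, Nat.add_sub_cancel_left, show r + 4 - 1 = r + 3 by omega,
    show r + 4 - 2 = r + 2 by omega] at *
  have hq : r + 3 ≤ c + 1 := by omega
  obtain ⟨𝒜, h1, h2, -, h4, h5⟩ := exists_compressed hY h𝒟 hq
  have e0 : (r + (c + 1)).choose (c + 1) = (r + (c + 1)).choose r := 
    (Nat.choose_symm_add).symm
  have e1 : (r + (c + 1) + 1).choose (c + 1) = (r + (c + 1) + 1).choose (r + 1) :=
    Nat.choose_symm_of_eq_add (by omega)
  have e2 : (r + (c + 1) + 2).choose (c + 1) = (r + (c + 1) + 2).choose (r + 2) :=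
    Nat.choose_symm_of_eq_add (by omega)
  by_cases hmid : 𝒟.card ≤ (r + (c + 1) + 1).choose (c + 1)
  · obtain ⟨𝒜', hA1, hA2, hA3⟩ := exists_split_top (q := r + 2) (by omega) (by omega)
      (h4 (r + (c + 1)) (by omega) (by omega)) (h5 (r + (c + 1) + 1) (by omega) hmid)
    have hA4 := card_mul_choose_le_card_lowerShadow_mul (card_range _) hA1 (by omega : r + 2 ≤ c)
    have e3 : (r + (c + 1)).choose c = (r + (c + 1)).choose (r + 1) :=
      Nat.choose_symm_of_eq_add (by omega)
    have e4 : (r + (c + 1)).choose (r + 1) ≤ (r + (c + 1)).choose (r + 2) :=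
      choose_le_choose_of_add_le (by omega) (by omega)
    have hpos : 0 < (r + (c + 1)).choose (r + 2) := Nat.choose_pos (by omega)
    have : 𝒜'.card ≤ (lowerShadow (r + 2) 𝒜').card := by
      refine Nat.le_of_mul_le_mul_right (hA4.trans ?_) hpos
      exact Nat.mul_le_mul_left _ (by omega)
    have hA3' : (r + (c + 1)).choose (r + 3) + (lowerShadow (r + 2) 𝒜').card ≤
      (lowerShadow (r + 3) 𝒜).card := hA3
    omega
  · obtain ⟨𝒜', hA1, hA2, hA3⟩ := exists_split_top (q := r + 2) (by omega) (by omega)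
      (h4 (r + (c + 1) + 1) (by omega) (by omega)) (h5 (r + (c + 1) + 1 + 1) (by omega)
        (by rw [show r + (c + 1) + 1 + 1 = r + (c + 1) + 2 by omega]; omega))
    have hA4 := card_mul_choose_le_card_lowerShadow_mul (card_range _) hA1 (by omega : r + 2 ≤ c)
    have e3 : (r + (c + 1) + 1).choose c = (r + (c + 1) + 1).choose (r + 2) :=
      Nat.choose_symm_of_eq_add (by omega)
    have hpos : 0 < (r + (c + 1) + 1).choose (r + 2) := Nat.choose_pos (by omega)
    have : 𝒜'.card ≤ (lowerShadow (r + 2) 𝒜').card := by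
      refine Nat.le_of_mul_le_mul_right (hA4.trans ?_) hpos
      exact Nat.mul_le_mul_left _ (by omega)
    have hA3' : (r + (c + 1) + 1).choose (r + 3) + (lowerShadow (r + 2) 𝒜').card ≤
      (lowerShadow (r + 3) 𝒜).card := hA3
    have e4 : (r + (c + 1)).choose (r + 1) ≤ (r + (c + 1)).choose (r + 2) :=
      choose_le_choose_of_add_le (by omega) (by omega)
    have e5 : (r + (c + 1) + 1).choose (r + 3) =
      (r + (c + 1)).choose (r + 2) + (r + (c + 1)).choose (r + 3) := Nat.choose_succ_succ _ _
    have e6 : (r + (c + 1) + 1).choose (r + 1) =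
      (r + (c + 1)).choose r + (r + (c + 1)).choose (r + 1) := Nat.choose_succ_succ _ _
    omega

/-- Removing a point splits a restricted neighbourhood into two smaller ones. -/
lemma card_nbr_filter_split {Y : Finset ℕ} {x q : ℕ} (𝒟 : Finset (Finset ℕ)) (hx : x ∈ Y)
    {Φ Φ₁ Φ₀ : Finset ℕ → Prop} [DecidablePred Φ] [DecidablePred Φ₁] [DecidablePred Φ₀]
    (h1 : ∀ E, Φ₁ E → Φ (insert x E)) (h0 : ∀ E, Φ₀ E → Φ E) :
    ((nbr (Y.erase x) q (𝒟.nonMemberSubfamily x)).filter Φ₁).card +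
      ((nbr (Y.erase x) (q + 1) (𝒟.memberSubfamily x)).filter Φ₀).card ≤
        ((nbr Y (q + 1) 𝒟).filter Φ).card := by
  set U := (nbr (Y.erase x) q (𝒟.nonMemberSubfamily x)).filter Φ₁ with hU
  set V := (nbr (Y.erase x) (q + 1) (𝒟.memberSubfamily x)).filter Φ₀ with hV
  have hUx : ∀ E ∈ U, x ∉ E := by
    intro E hE h
    simpa using (mem_nbr.1 (mem_filter.1 hE).1).1.1 h
  have hVx : ∀ E ∈ V, x ∉ E := by
    intro E hE h
    simpa using (mem_nbr.1 (mem_filter.1 hE).1).1.1 h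
  have hUc : (U.image (insert x)).card = U.card := by
    refine card_image_of_injOn fun E hE E' hE' h => ?_
    rw [← erase_insert (hUx E hE), ← erase_insert (hUx E' hE')]
    exact congrArg (fun s => s.erase x) h
  have hdisj : Disjoint (U.image (insert x)) V := by
    rw [disjoint_left]
    intro E hE hE'
    obtain ⟨E'', -, rfl⟩ := mem_image.1 hE
    exact hVx _ hE' (mem_insert_self _ _)
  rw [← hUc, ← card_union_of_disjoint hdisj]
  refine card_le_card (union_subset ?_ ?_)
  · intro E' hE'
    obtain ⟨E, hE, rfl⟩ := mem_image.1 hE'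
    have hxE := hUx E hE
    obtain ⟨hE, hΦ⟩ := mem_filter.1 hE
    obtain ⟨⟨hEY, hEq⟩, D, hD, hDE⟩ := mem_nbr.1 hE
    rw [mem_nonMemberSubfamily] at hD
    refine mem_filter.2 ⟨mem_nbr.2 ⟨⟨insert_subset hx (hEY.trans (erase_subset _ _)), ?_⟩,
      D, hD.1, disjoint_insert_right.2 ⟨hD.2, hDE⟩⟩, h1 E hΦ⟩
    rw [card_insert_of_notMem hxE, hEq]
  · intro E hE
    have hxE := hVx E hE
    obtain ⟨hE, hΦ⟩ := mem_filter.1 hE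
    obtain ⟨⟨hEY, hEq⟩, D, hD, hDE⟩ := mem_nbr.1 hE
    rw [mem_memberSubfamily] at hD
    exact mem_filter.2 ⟨mem_nbr.2 ⟨⟨hEY.trans (erase_subset _ _), hEq⟩, insert x D, hD.1,
      disjoint_insert_left.2 ⟨hxE, hDE⟩⟩, h0 E hΦ⟩

lemma nonMemberSubfamily_subset_powersetCard {Y : Finset ℕ} {x p : ℕ} {𝒟 : Finset (Finset ℕ)}
    (h𝒟 : 𝒟 ⊆ Y.powersetCard p) :
    𝒟.nonMemberSubfamily x ⊆ (Y.erase x).powersetCard p := by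
  intro D hD
  rw [mem_nonMemberSubfamily] at hD
  have := mem_powersetCard.1 (h𝒟 hD.1)
  exact mem_powersetCard.2 ⟨subset_erase.2 ⟨this.1, hD.2⟩, this.2⟩

lemma memberSubfamily_subset_powersetCard {Y : Finset ℕ} {x p : ℕ} {𝒟 : Finset (Finset ℕ)}
    (h𝒟 : 𝒟 ⊆ Y.powersetCard (p + 1)) :
    𝒟.memberSubfamily x ⊆ (Y.erase x).powersetCard p := by
  intro D hD
  rw [mem_memberSubfamily] at hD
  have := mem_powersetCard.1 (h𝒟 hD.1)
  rw [card_insert_of_notMem hD.2] at this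
  exact mem_powersetCard.2 ⟨subset_erase.2 ⟨(subset_insert _ _).trans this.1, hD.2⟩, by omega⟩

/-- The induction step shared by the peeling arguments. -/
lemma card_lt_card_nbr_filter_of_split {Y : Finset ℕ} {x p c q : ℕ} {𝒟 : Finset (Finset ℕ)}
    (hx : x ∈ Y) (hY : Y.card = p + (c + 1)) (h𝒟 : 𝒟 ⊆ Y.powersetCard p) (hne : 𝒟.Nonempty)
    {Φ Φ₁ Φ₀ : Finset ℕ → Prop} [DecidablePred Φ] [DecidablePred Φ₁] [DecidablePred Φ₀]
    (h1 : ∀ E, Φ₁ E → Φ (insert x E)) (h0 : ∀ E, Φ₀ E → Φ E)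
    (hnon : (Y.erase x).card = p + c → 𝒟.nonMemberSubfamily x ⊆ (Y.erase x).powersetCard p →
      (𝒟.nonMemberSubfamily x).Nonempty → (𝒟.nonMemberSubfamily x).card ≤ 𝒟.card →
      (𝒟.nonMemberSubfamily x).card <
        ((nbr (Y.erase x) q (𝒟.nonMemberSubfamily x)).filter Φ₁).card)
    (hmem : ∀ p', p = p' + 1 → (Y.erase x).card = p' + (c + 1) →
      𝒟.memberSubfamily x ⊆ (Y.erase x).powersetCard p' →
      (𝒟.memberSubfamily x).Nonempty → (𝒟.memberSubfamily x).card ≤ 𝒟.card →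
      (𝒟.memberSubfamily x).card <
        ((nbr (Y.erase x) (q + 1) (𝒟.memberSubfamily x)).filter Φ₀).card) :
    𝒟.card < ((nbr Y (q + 1) 𝒟).filter Φ).card := by
  have hsplit := card_nbr_filter_split (q := q) 𝒟 hx h1 h0
  have hsum := card_memberSubfamily_add_card_nonMemberSubfamily x 𝒟
  have hpos := card_pos.2 hne
  have hYc := card_erase_of_mem hx
  have A0 := hnon (by omega) (nonMemberSubfamily_subset_powersetCard h𝒟)
  have A1 : (𝒟.memberSubfamily x).Nonempty → (𝒟.memberSubfamily x).card <
        ((nbr (Y.erase x) (q + 1) (𝒟.memberSubfamily x)).filter Φ₀).card := by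
    intro hn
    obtain ⟨D, hD⟩ := hn
    have hD' := mem_memberSubfamily.1 hD
    have := (mem_powersetCard.1 (h𝒟 hD'.1)).2
    rw [card_insert_of_notMem hD'.2] at this
    obtain rfl : p = D.card + 1 := this.symm
    exact hmem D.card rfl (by omega) (memberSubfamily_subset_powersetCard h𝒟) ⟨D, hD⟩ (by omega)
  rcases (𝒟.memberSubfamily x).eq_empty_or_nonempty with h | h
  · rcases (𝒟.nonMemberSubfamily x).eq_empty_or_nonempty with h' | h'
    · rw [h, h', card_empty] at hsum
      omega
    · have := A0 h' (by omega)
      rw [h, card_empty] at hsum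
      omega
  · have a1 := A1 h
    rcases (𝒟.nonMemberSubfamily x).eq_empty_or_nonempty with h' | h'
    · rw [h', card_empty] at hsum
      omega
    · have := A0 h' (by omega)
      omega

lemma filter_nbr_true (Y : Finset ℕ) (q : ℕ) (𝒟 : Finset (Finset ℕ)) :
    (nbr Y q 𝒟).filter (fun _ => True) = nbr Y q 𝒟 := filter_true _

lemma card_lt_card_nbr_meets {c q : ℕ} (hqc : q < c) (S : Finset ℕ) :
    ∀ (p : ℕ) (Y : Finset ℕ) (𝒟 : Finset (Finset ℕ)), S ⊆ Y → Y.card = p + (c + 1) →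
      𝒟 ⊆ Y.powersetCard p → (∀ D ∈ 𝒟, ¬ S ⊆ D) → 𝒟.Nonempty → 𝒟.card < (c + q).choose q →
      𝒟.card < ((nbr Y (q + 1) 𝒟).filter (fun E => (E ∩ S).Nonempty)).card := by
  induction S using Finset.induction_on with
  | empty =>
    intro p Y 𝒟 _ _ _ h ⟨D, hD⟩
    exact absurd (empty_subset D) (h D hD)
  | insert x S hxS ih =>
    intro p Y 𝒟 hSY hY h𝒟 hS hne hlt
    refine card_lt_card_nbr_filter_of_split (Φ₁ := fun _ => True)
      (Φ₀ := fun E => (E ∩ S).Nonempty) (hSY (mem_insert_self _ _)) hY h𝒟 hne ?_ ?_ ?_ ?_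
    · exact fun E _ => ⟨x, by simp⟩
    · exact fun E hE => hE.mono (inter_subset_inter_left (subset_insert _ _))
    · intro g1 g2 g3 g4
      rw [filter_nbr_true]
      exact card_lt_card_nbr g1 g2 hqc (card_pos.2 g3) (g4.trans_lt hlt)
    · intro p' hp g1 g2 g3 g4
      refine ih p' _ _ (subset_erase.2 ⟨(subset_insert _ _).trans hSY, hxS⟩) g1 g2 ?_ g3
        (g4.trans_lt hlt)
      intro D hD hSD
      exact hS _ (mem_memberSubfamily.1 hD).1 (insert_subset_insert _ hSD)

/-- The numerical inequality behind the dense case of `card_lt_card_nbr_meets_of_dense`. -/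
lemma mul_choose_lt_mul_choose {c r : ℕ} (hc : r + 4 ≤ c) (hr : 2 ≤ r) :
    c * (c - 1).choose (r + 2) < (c - (r + 3)) * (c + r + 1).choose (r + 2) := by
  obtain ⟨e, rfl⟩ : ∃ e, c = r + 4 + e := ⟨c - (r + 4), by omega⟩
  have h1 := Nat.choose_mul_succ_eq (r + 3 + e) (r + 2)
  have h2 := Nat.choose_mul_succ_eq (r + 4 + e) (r + 2)
  have h3 : (r + 4 + e + 1).choose (r + 2) ≤ (r + 4 + e + r + 1).choose (r + 2) :=
    Nat.choose_le_choose _ (by omega)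
  have hpos : 0 < (r + 3 + e).choose (r + 2) := Nat.choose_pos (by omega)
  rw [show r + 4 + e - 1 = r + 3 + e by omega, show r + 4 + e - (r + 3) = e + 1 by omega]
  rw [show r + 3 + e + 1 - (r + 2) = e + 2 by omega, show r + 3 + e + 1 = r + 4 + e by omega] at h1
  rw [show r + 4 + e + 1 - (r + 2) = e + 3 by omega] at h2
  set u := (r + 3 + e).choose (r + 2)
  set v := (r + 4 + e).choose (r + 2)
  set w := (r + 4 + e + 1).choose (r + 2)
  have h4 : w * ((e + 2) * (e + 3)) = (r + 4 + e + 1) * ((r + 4 + e) * u) := by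
    calc w * ((e + 2) * (e + 3)) = w * (e + 3) * (e + 2) := by ring
      _ = (r + 4 + e + 1) * (v * (e + 2)) := by rw [← h2]; ring
      _ = _ := by rw [← h1]; ring
  have h5 : (e + 2) * (e + 3) < (e + 1) * (r + 4 + e + 1) := by nlinarith
  have h6 : 0 < (r + 4 + e) * u := Nat.mul_pos (by omega) hpos
  refine lt_of_lt_of_le (Nat.lt_of_mul_lt_mul_right (a := (e + 2) * (e + 3)) ?_)
    (Nat.mul_le_mul_left _ h3)
  calc (r + 4 + e) * u * ((e + 2) * (e + 3))
      < (r + 4 + e) * u * ((e + 1) * (r + 4 + e + 1)) := Nat.mul_lt_mul_of_pos_left h5 h6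
    _ = (e + 1) * w * ((e + 2) * (e + 3)) := by rw [mul_assoc (e + 1), h4]; ring

/-- The range of sizes that does not occur for small uniformities. -/
lemma choose_lt_choose_of_small {c r : ℕ} (hc : r + 4 ≤ c) (hr : r < 2) :
    (c + r + 2).choose (r + 1) < (c + r + 1).choose (r + 2) := by
  obtain rfl | rfl : r = 0 ∨ r = 1 := by omega
  · have h := Nat.choose_succ_right_eq (c + 1) 1
    simp only [Nat.choose_one_right, Nat.add_sub_cancel, Nat.add_zero, Nat.zero_add] at *
    nlinarith
  · have h1 := Nat.choose_succ_right_eq (c + 3) 1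
    have h2 := Nat.choose_succ_right_eq (c + 2) 1
    have h3 := Nat.choose_succ_right_eq (c + 2) 2
    simp only [Nat.choose_one_right, Nat.add_sub_cancel, Nat.reduceAdd,
      show c + 1 + 2 = c + 3 by omega, show c + 1 + 1 = c + 2 by omega,
      show c + 3 - 1 = c + 2 by omega, show c + 2 - 1 = c + 1 by omega] at *
    obtain ⟨d, rfl⟩ : ∃ d, c = d + 5 := ⟨c - 5, by omega⟩
    nlinarith

lemma card_lt_card_nbr_meets_of_dense {p c r : ℕ} {Y S : Finset ℕ} {𝒟 : Finset (Finset ℕ)}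
    (hc : r + 4 ≤ c) (hSY : S ⊆ Y) (hY : Y.card = p + c) (h𝒟 : 𝒟 ⊆ Y.powersetCard p)
    (hSp : p ≤ S.card) (hS : ∀ D ∈ 𝒟, ¬ S ⊆ D) (hne : 𝒟.Nonempty)
    (hT : 𝒟.card ≤ (c + r + 2).choose (r + 1)) :
    𝒟.card < ((nbr Y (r + 3) 𝒟).filter (fun E => (E ∩ S).Nonempty)).card := by
  by_cases hlt : 𝒟.card < (c + r + 1).choose (r + 2)
  · obtain ⟨c, rfl⟩ : ∃ c', c = c' + 1 := ⟨c - 1, by omega⟩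
    refine card_lt_card_nbr_meets (by omega) S p Y 𝒟 hSY hY h𝒟 hS hne ?_
    convert hlt using 2
    omega
  push Not at hlt
  have hr : 2 ≤ r := by
    by_contra h
    have := choose_lt_choose_of_small hc (by omega : r < 2)
    omega
  have hp : r + 2 ≤ p := by
    by_contra h
    have h1 := card_le_card h𝒟
    rw [card_powersetCard, hY] at h1
    have h2 : (p + c).choose p ≤ (c + r + 1).choose p := Nat.choose_le_choose _ (by omega)
    have h3 : (c + r + 1).choose p < (c + r + 1).choose (r + 2) :=
      choose_lt_choose_of_add_lt (by omega) (by omega)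
    omega
  have e1 : (c + r + 2).choose c = (c + r + 2).choose (r + 2) := Nat.choose_symm_of_eq_add rfl
  have e2 : (c + r + 2).choose (r + 1) ≤ (c + r + 2).choose (r + 2) :=
    choose_le_choose_of_add_le (by omega) (by omega)
  have h1 := card_le_choose_of_nbr (q := r + 3) (N := c + r + 2) hY h𝒟 (by omega) (by omega)
    (by omega)
  have e3 := Nat.choose_succ_right_eq (c + r + 2) (r + 2)
  rw [e1, show c + r + 2 - (r + 2) = c by omega] at *
  have hpos : 0 < (c + r + 2).choose (r + 2) := Nat.choose_pos (by omega)
  have h2 : 𝒟.card * c ≤ (nbr Y (r + 3) 𝒟).card * (r + 3) := by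
    refine Nat.le_of_mul_le_mul_right ?_ hpos
    calc 𝒟.card * c * (c + r + 2).choose (r + 2)
        = 𝒟.card * ((c + r + 2).choose (r + 2) * c) := by ring
      _ = 𝒟.card * (c + r + 2).choose (r + 3) * (r + 3) := by rw [← e3]; ring
      _ ≤ (nbr Y (r + 3) 𝒟).card * (c + r + 2).choose (r + 2) * (r + 3) :=
        Nat.mul_le_mul_right _ h1
      _ = _ := by ring
  have h3 : ((nbr Y (r + 3) 𝒟).filter (fun E => ¬ (E ∩ S).Nonempty)).card ≤ c.choose (r + 3) := by
    have : (Y \ S).card ≤ c := by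
      rw [card_sdiff_of_subset hSY, hY]
      omega
    refine le_trans ?_ (Nat.choose_le_choose _ this)
    rw [← card_powersetCard]
    refine card_le_card fun E hE => ?_
    obtain ⟨hE, hES⟩ := mem_filter.1 hE
    rw [not_nonempty_iff_eq_empty, ← disjoint_iff_inter_eq_empty] at hES
    obtain ⟨⟨h4, h5⟩, -⟩ := mem_nbr.1 hE
    exact mem_powersetCard.2 ⟨subset_sdiff.2 ⟨h4, hES⟩, h5⟩
  have h4 := card_filter_add_card_filter_not (s := nbr Y (r + 3) 𝒟) (fun E => (E ∩ S).Nonempty)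
  have h5 := mul_choose_lt_mul_choose hc hr
  have h6 : c.choose (r + 3) * (r + 3) = c * (c - 1).choose (r + 2) := by
    obtain ⟨c, rfl⟩ : ∃ c', c = c' + 1 := ⟨c - 1, by omega⟩
    rw [Nat.add_sub_cancel, Nat.add_one_mul_choose_eq]
  have h7 : (c - (r + 3)) * (c + r + 1).choose (r + 2) ≤ (c - (r + 3)) * 𝒟.card :=
    Nat.mul_le_mul_left _ hlt
  obtain ⟨e, rfl⟩ : ∃ e, c = r + 3 + e := ⟨c - (r + 3), by omega⟩
  rw [show r + 3 + e - (r + 3) = e by omega] at *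
  by_contra hcon
  push Not at hcon
  set f := ((nbr Y (r + 3) 𝒟).filter (fun E => (E ∩ S).Nonempty)).card
  set g := ((nbr Y (r + 3) 𝒟).filter (fun E => ¬ (E ∩ S).Nonempty)).card
  have h8 := Nat.mul_le_mul_right (r + 3) hcon
  have h9 := Nat.mul_le_mul_right (r + 3) h3
  rw [← h4] at h2
  nlinarith

lemma card_lt_card_nbr_meets_both {c r : ℕ} (hc : r + 4 ≤ c) (S S' : Finset ℕ)
    (hdisj : Disjoint S S') :
    ∀ (p : ℕ) (Y : Finset ℕ) (𝒟 : Finset (Finset ℕ)), S ⊆ Y → S' ⊆ Y → Y.card = p + (c + 1) →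
      𝒟 ⊆ Y.powersetCard p → p ≤ S'.card → (∀ D ∈ 𝒟, ¬ S ⊆ D) → (∀ D ∈ 𝒟, ¬ S' ⊆ D) →
      𝒟.Nonempty → 𝒟.card ≤ (c + r + 2).choose (r + 1) →
      𝒟.card < ((nbr Y (r + 4) 𝒟).filter
        (fun E => (E ∩ S).Nonempty ∧ (E ∩ S').Nonempty)).card := by
  induction S using Finset.induction_on with
  | empty =>
    intro p Y 𝒟 _ _ _ _ _ h _ ⟨D, hD⟩
    exact absurd (empty_subset D) (h D hD)
  | insert x S hxS ih =>
    intro p Y 𝒟 hSY hSY' hY h𝒟 hp hS hS' hne hT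
    rw [disjoint_insert_left] at hdisj
    refine card_lt_card_nbr_filter_of_split (q := r + 3) (Φ₁ := fun E => (E ∩ S').Nonempty)
      (Φ₀ := fun E => (E ∩ S).Nonempty ∧ (E ∩ S').Nonempty)
      (hSY (mem_insert_self _ _)) hY h𝒟 hne ?_ ?_ ?_ ?_
    · exact fun E hE => ⟨⟨x, by simp⟩, hE.mono (inter_subset_inter_right (subset_insert _ _))⟩
    · exact fun E hE => ⟨hE.1.mono (inter_subset_inter_left (subset_insert _ _)), hE.2⟩
    · intro g1 g2 g3 g4
      exact card_lt_card_nbr_meets_of_dense hc (subset_erase.2 ⟨hSY', hdisj.1⟩) g1 g2 hp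
        (fun D hD => hS' D (mem_nonMemberSubfamily.1 hD).1) g3 (g4.trans hT)
    · intro p' hp' g1 g2 g3 g4
      refine ih hdisj.2 p' _ _ (subset_erase.2 ⟨(subset_insert _ _).trans hSY, hxS⟩)
        (subset_erase.2 ⟨hSY', hdisj.1⟩) g1 g2 (by omega) ?_ ?_ g3 (g4.trans hT)
      · intro D hD hSD
        exact hS _ (mem_memberSubfamily.1 hD).1 (insert_subset_insert _ hSD)
      · intro D hD hSD
        exact hS' _ (mem_memberSubfamily.1 hD).1 (hSD.trans (subset_insert _ _))

lemma card_lt_card_nbr_meets_or {c r : ℕ} (hc : r + 4 ≤ c) (S S' : Finset ℕ)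
    (hdisj : Disjoint S S') (I : Finset ℕ) (hIS : Disjoint I S) (hIS' : Disjoint I S') :
    ∀ (p : ℕ) (Y : Finset ℕ) (𝒟 : Finset (Finset ℕ)), I ⊆ Y → S ⊆ Y → S' ⊆ Y →
      Y.card = p + (c + 1) → 𝒟 ⊆ Y.powersetCard p → p ≤ S'.card + I.card →
      (∀ D ∈ 𝒟, ¬ I ∪ S ⊆ D) → (∀ D ∈ 𝒟, ¬ I ∪ S' ⊆ D) →
      𝒟.Nonempty → 𝒟.card ≤ (c + r + 2).choose (r + 1) →
      𝒟.card < ((nbr Y (r + 4) 𝒟).filter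
        (fun E => (E ∩ I).Nonempty ∨ (E ∩ S).Nonempty ∧ (E ∩ S').Nonempty)).card := by
  induction I using Finset.induction_on with
  | empty =>
    intro p Y 𝒟 _ hSY hSY' hY h𝒟 hp hS hS' hne hT
    simp only [empty_union, card_empty, add_zero] at hp hS hS'
    refine (card_lt_card_nbr_meets_both hc S S' hdisj p Y 𝒟 hSY hSY' hY h𝒟 hp hS hS' hne hT).trans_le
      (card_le_card fun E hE => ?_)
    rw [mem_filter] at hE ⊢
    exact ⟨hE.1, Or.inr hE.2⟩
  | insert x I hxI ih =>
    intro p Y 𝒟 hIY hSY hSY' hY h𝒟 hp hS hS' hne hT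
    rw [disjoint_insert_left] at hIS hIS'
    rw [card_insert_of_notMem hxI] at hp
    refine card_lt_card_nbr_filter_of_split (q := r + 3) (Φ₁ := fun E => True)
      (Φ₀ := fun E => (E ∩ I).Nonempty ∨ (E ∩ S).Nonempty ∧ (E ∩ S').Nonempty)
      (hIY (mem_insert_self _ _)) hY h𝒟 hne ?_ ?_ ?_ ?_
    · exact fun E hE => Or.inl ⟨x, by simp⟩
    · exact fun E hE => hE.imp_left fun h => h.mono (inter_subset_inter_left (subset_insert _ _))
    · intro g1 g2 g3 g4
      rw [filter_nbr_true]
      refine card_lt_card_nbr g1 g2 (by omega) (card_pos.2 g3) ((g4.trans hT).trans_lt ?_)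
      have e1 : (c + (r + 3)).choose (r + 3) =
        (c + r + 2).choose (r + 2) + (c + r + 2).choose (r + 3) := Nat.choose_succ_succ _ _
      have e2 : (c + r + 2).choose (r + 1) ≤ (c + r + 2).choose (r + 2) :=
        choose_le_choose_of_add_le (by omega) (by omega)
      have e3 : 0 < (c + r + 2).choose (r + 3) := Nat.choose_pos (by omega)
      omega
    · intro p' hp' g1 g2 g3 g4
      refine ih hIS.2 hIS'.2 p' _ _ (subset_erase.2 ⟨(subset_insert _ _).trans hIY, hxI⟩)
        (subset_erase.2 ⟨hSY, hIS.1⟩)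
        (subset_erase.2 ⟨hSY', hIS'.1⟩) g1 g2 (by omega) ?_ ?_ g3 (g4.trans hT)
      · intro D hD hSD
        refine hS _ (mem_memberSubfamily.1 hD).1 ?_
        rw [insert_union]
        exact insert_subset_insert _ hSD
      · intro D hD hSD
        refine hS' _ (mem_memberSubfamily.1 hD).1 ?_
        rw [insert_union]
        exact insert_subset_insert _ hSD

/-- A small family is dominated by any two of its members. -/
lemma card_nbr_pair_lt {k m : ℕ} {X A B : Finset ℕ} {𝒢 : Finset (Finset ℕ)} (hk : 5 ≤ k)
    (hm : 2 * k ≤ m) (hX : X.card = m) (h𝒢 : 𝒢 ⊆ X.powersetCard k) (hA : A ∈ 𝒢) (hB : B ∈ 𝒢)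
    (hAB : A ≠ B) (h2 : 2 < 𝒢.card) (hT : 𝒢.card ≤ (m - 4).choose (k - 4)) :
    (nbr X (k - 1) {A, B}).card + 𝒢.card < (nbr X (k - 1) 𝒢).card + 2 := by
  obtain ⟨r, rfl⟩ : ∃ r, k = r + 5 := ⟨k - 5, by omega⟩
  obtain ⟨c, rfl⟩ : ∃ c, m = r + 5 + (c + 1) := ⟨m - r - 6, by omega⟩
  rw [show r + 5 + (c + 1) - 4 = c + r + 2 by omega, show r + 5 - 4 = r + 1 by omega] at hT
  rw [show r + 5 - 1 = r + 4 by omega]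
  have hsub : ({A, B} : Finset (Finset ℕ)) ⊆ 𝒢 := by
    intro D hD
    rcases mem_insert.1 hD with rfl | hD
    · exact hA
    · rwa [mem_singleton.1 hD]
  have hcard : (𝒢 \ {A, B}).card + 2 = 𝒢.card := by
    rw [← card_sdiff_add_card_eq_card hsub, card_pair hAB]
  have hpr : ∀ D ∈ 𝒢, D ⊆ X ∧ D.card = r + 5 := fun D hD => mem_powersetCard.1 (h𝒢 hD)
  have hall : ∀ C ∈ ({A, B} : Finset (Finset ℕ)), ∀ D ∈ 𝒢 \ {A, B}, ¬ C ⊆ D := by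
    intro C hC D hD hCD
    rw [mem_sdiff] at hD
    have := eq_of_subset_of_card_le hCD (by rw [(hpr D hD.1).2, (hpr C (hsub hC)).2])
    exact hD.2 (this ▸ hC)
  have key := card_lt_card_nbr_meets_or (c := c) (r := r) (by omega) (A \ B) (B \ A)
    disjoint_sdiff_sdiff (A ∩ B)
    (disjoint_sdiff.mono_left inter_subset_right) (disjoint_sdiff.mono_left inter_subset_left)
    (r + 5) X (𝒢 \ {A, B}) (inter_subset_left.trans (hpr A hA).1)
    (sdiff_subset.trans (hpr A hA).1) (sdiff_subset.trans (hpr B hB).1) hX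
    (sdiff_subset.trans h𝒢)
    (by rw [inter_comm, card_sdiff_add_card_inter, (hpr B hB).2])
    (by rw [union_comm, sdiff_union_inter]; exact hall A (by simp))
    (by rw [union_comm, inter_comm, sdiff_union_inter]; exact hall B (by simp))
    (card_pos.1 (by omega)) (by omega)
  set V := (nbr X (r + 4) (𝒢 \ {A, B})).filter (fun E => (E ∩ (A ∩ B)).Nonempty ∨
    (E ∩ (A \ B)).Nonempty ∧ (E ∩ (B \ A)).Nonempty) with hV
  have hdisj : Disjoint (nbr X (r + 4) {A, B}) V := by
    rw [disjoint_left]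
    intro E hE hE'
    obtain ⟨-, D, hD, hDE⟩ := mem_nbr.1 hE
    have hmeet := (mem_filter.1 hE').2
    have hA' : (A ∩ E).Nonempty ∧ (B ∩ E).Nonempty := by
      rcases hmeet with ⟨x, hx⟩ | ⟨⟨x, hx⟩, ⟨y, hy⟩⟩
      · simp only [mem_inter] at hx
        exact ⟨⟨x, by simp [hx]⟩, ⟨x, by simp [hx]⟩⟩
      · simp only [mem_inter, mem_sdiff] at hx hy
        exact ⟨⟨x, by simp [hx]⟩, ⟨y, by simp [hy]⟩⟩
    rw [disjoint_iff_inter_eq_empty] at hDE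
    simp only [mem_insert, mem_singleton] at hD
    rcases hD with rfl | rfl
    · exact hA'.1.ne_empty hDE
    · exact hA'.2.ne_empty hDE
  have hle := card_le_card (union_subset (nbr_mono (Y := X) (q := r + 4) hsub)
    ((filter_subset _ _).trans (nbr_mono (Y := X) (q := r + 4) sdiff_subset) : V ⊆ nbr X (r + 4) 𝒢))
  rw [card_union_of_disjoint hdisj] at hle
  omega

/-- A compressed `t`-intersecting family is no larger than its disjointness neighbourhood. -/
lemma card_le_card_nbr_of_compressed (prec : ℕ → ℕ → Prop)
    (hprec : ∀ Y : Finset ℕ, Y.Nonempty → ∃ x ∈ Y, ∀ y ∈ Y, y ≠ x → prec x y) :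
    ∀ (N : ℕ) (Y : Finset ℕ) (k l t : ℕ) (R : Finset (Finset ℕ)), Y.card = N →
      R ⊆ Y.powersetCard k → (∀ D ∈ R, ∀ D' ∈ R, t ≤ (D ∩ D').card) →
      (∀ x ∈ Y, ∀ y ∈ Y, prec x y → ∀ D ∈ R, y ∈ D → x ∉ D → insert x (D.erase y) ∈ R) →
      k ≤ l + t → l + k ≤ N → R.card ≤ (nbr Y l R).card := by
  intro N
  induction N with
  | zero =>
    intro Y k l t R hY hR hint hst hkl hN
    obtain rfl : l = 0 := by omega
    obtain rfl : k = 0 := by omega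
    rcases R.eq_empty_or_nonempty with rfl | ⟨D, hD⟩
    · simp
    · have h1 := card_le_card hR
      simp only [powersetCard_zero, card_singleton] at h1
      refine h1.trans (card_pos.2 ⟨∅, mem_nbr.2 ⟨by simp, D, hD, by simp⟩⟩)
  | succ N ih =>
    intro Y k l t R hY hR hint hst hkl hN
    rcases R.eq_empty_or_nonempty with rfl | ⟨D₀, hD₀⟩
    · simp
    have hR' : ∀ D ∈ R, D ⊆ Y ∧ D.card = k := fun D hD => mem_powersetCard.1 (hR hD)
    have htk : t ≤ k := by
      have := hint D₀ hD₀ D₀ hD₀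
      rwa [inter_self, (hR' D₀ hD₀).2] at this
    obtain _ | l := l
    · have h1 : R.card ≤ 1 := by
        refine card_le_one.2 fun D hD D' hD' => ?_
        have h2 := hint D hD D' hD'
        have h3 : D ∩ D' = D := eq_of_subset_of_card_le inter_subset_left
          (by rw [(hR' D hD).2]; omega)
        exact eq_of_subset_of_card_le (inter_eq_left.1 h3)
          (by rw [(hR' D hD).2, (hR' D' hD').2])
      exact h1.trans (card_pos.2 ⟨∅, mem_nbr.2 ⟨by simp, D₀, hD₀, by simp⟩⟩)
    obtain _ | t := t
    · have h1 := card_le_choose_of_nbr (p := k) (c := N + 1 - k) (q := l + 1) (N := N + 1)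
        (by omega) hR (by omega) (by omega)
        (by
          have := card_le_card hR
          rwa [card_powersetCard, hY, ← Nat.choose_symm (by omega : k ≤ N + 1)] at this)
      rw [Nat.choose_symm (by omega : k ≤ N + 1)] at h1
      have h2 : (N + 1).choose k ≤ (N + 1).choose (l + 1) :=
        choose_le_choose_of_add_le (by omega) (by omega)
      exact Nat.le_of_mul_le_mul_right (h1.trans (Nat.mul_le_mul_left _ h2))
        (Nat.choose_pos (by omega))
    obtain ⟨k, rfl⟩ : ∃ k', k = k' + 1 := ⟨k - 1, by omega⟩
    obtain ⟨x, hx, hmin⟩ := hprec Y (card_pos.1 (by omega))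
    have hYx : (Y.erase x).card = N := by rw [card_erase_of_mem hx, hY]; rfl
    have hsplit := card_nbr_filter_split (q := l) R hx (Φ := fun _ => True) (Φ₁ := fun _ => True)
      (Φ₀ := fun _ => True) (fun _ h => h) (fun _ h => h)
    simp only [filter_nbr_true] at hsplit
    have hsum := card_memberSubfamily_add_card_nonMemberSubfamily x R
    have h1 := ih (Y.erase x) (k + 1) l (t + 2) (R.nonMemberSubfamily x) hYx
      (nonMemberSubfamily_subset_powersetCard hR) ?_ ?_ (by omega) (by omega)
    · have h2 := ih (Y.erase x) k (l + 1) t (R.memberSubfamily x) hYx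
        (memberSubfamily_subset_powersetCard hR) ?_ ?_ (by omega) (by omega)
      · omega
      · intro D hD D' hD'
        rw [mem_memberSubfamily] at hD hD'
        have := hint _ hD.1 _ hD'.1
        rw [← insert_inter_distrib, card_insert_of_notMem (by simp [hD.2])] at this
        omega
      · intro z hz y hy hzy D hD hyD hzD
        rw [mem_memberSubfamily] at hD ⊢
        have hzx := ne_of_mem_erase hz
        have hyx := ne_of_mem_erase hy
        have := hst z (mem_of_mem_erase hz) y (mem_of_mem_erase hy) hzy _ hD.1
          (mem_insert_of_mem hyD) (by simp [hzx, hzD])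
        refine ⟨?_, by simp [hzx.symm, hD.2]⟩
        rwa [insert_comm, ← erase_insert_of_ne hyx.symm]
    · intro D hD D' hD'
      rw [mem_nonMemberSubfamily] at hD hD'
      by_contra hcon
      have h3 := hint D hD.1 D' hD'.1
      obtain ⟨y, hy⟩ : (D ∩ D').Nonempty := card_pos.1 (by omega)
      have hyD := mem_inter.1 hy
      have hyY := (hR' D hD.1).1 hyD.1
      have h4 := hst x hx y hyY (hmin y hyY fun h => hD.2 (h ▸ hyD.1)) D hD.1 hyD.1 hD.2
      have h5 := hint _ h4 D' hD'.1
      have h6 : insert x (D.erase y) ∩ D' ⊆ (D ∩ D').erase y := by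
        intro z hz
        simp only [mem_inter, mem_insert, mem_erase] at hz ⊢
        rcases hz with ⟨rfl | hz, hz'⟩
        · exact absurd hz' hD'.2
        · exact ⟨hz.1, hz.2, hz'⟩
      have h7 := card_le_card h6
      rw [card_erase_of_mem hy] at h7
      omega
    · intro z hz y hy hzy D hD hyD hzD
      rw [mem_nonMemberSubfamily] at hD ⊢
      have hzx := ne_of_mem_erase hz
      refine ⟨hst z (mem_of_mem_erase hz) y (mem_of_mem_erase hy) hzy D hD.1 hyD hzD, ?_⟩
      simp [hzx.symm, hD.2]

lemma card_add_card_nbr_le {Y : Finset ℕ} {q : ℕ} {H 𝒟 : Finset (Finset ℕ)}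
    (hH : H ⊆ Y.powersetCard q) (hcross : ∀ D ∈ 𝒟, ∀ E ∈ H, (D ∩ E).Nonempty) :
    H.card + (nbr Y q 𝒟).card ≤ Y.card.choose q := by
  have hdisj : Disjoint H (nbr Y q 𝒟) := by
    rw [disjoint_left]
    intro E hE hE'
    obtain ⟨-, D, hD, hDE⟩ := mem_nbr.1 hE'
    exact (hcross D hD E hE).ne_empty (disjoint_iff_inter_eq_empty.1 hDE)
  rw [← card_powersetCard, ← card_union_of_disjoint hdisj]
  exact card_le_card (union_subset hH (filter_subset _ _))

/-- The extremal bound for two large cross-intersecting families. -/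
lemma card_add_card_le_of_cross {Z : Finset ℕ} {m k : ℕ} {P Q : Finset (Finset ℕ)}
    (hk : 4 ≤ k) (hm : 2 * k ≤ m) (hZ : Z.card = m - 1) (hP : P ⊆ Z.powersetCard (k - 1))
    (hQ : Q ⊆ Z.powersetCard (k - 1)) (hcross : ∀ D ∈ P, ∀ E ∈ Q, (D ∩ E).Nonempty)
    (hPT : (m - 4).choose (k - 4) ≤ P.card) (hQT : (m - 4).choose (k - 4) ≤ Q.card) :
    P.card + Q.card + (m - 4).choose (k - 1) ≤ (m - 1).choose (k - 1) + (m - 4).choose (k - 4) := by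
  have main : ∀ P Q : Finset (Finset ℕ), P ⊆ Z.powersetCard (k - 1) → Q ⊆ Z.powersetCard (k - 1) →
      (∀ D ∈ P, ∀ E ∈ Q, (D ∩ E).Nonempty) → (m - 4).choose (k - 4) ≤ P.card →
      P.card ≤ (m - 2).choose (k - 2) →
      P.card + Q.card + (m - 4).choose (k - 1) ≤
        (m - 1).choose (k - 1) + (m - 4).choose (k - 4) := by
    intro P Q hP hQ hcross hPT hPle
    have h1 := card_add_choose_le_card_nbr (p := k - 1) hk hm (by omega) (by omega) hP hPT hPle
    have h2 := card_add_card_nbr_le hQ hcross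
    rw [hZ] at h2
    omega
  by_cases hPle : P.card ≤ (m - 2).choose (k - 2)
  · exact main P Q hP hQ hcross hPT hPle
  have hQle : Q.card ≤ (m - 2).choose (k - 2) := by
    have e1 : (m - 2).choose (m - k) = (m - 2).choose (k - 2) :=
      Nat.choose_symm_of_eq_add (by omega)
    have h1 := choose_le_card_nbr (Y := Z) (p := k - 1) (c := m - k) (q := k - 1) (N := m - 2)
      (by omega) hP (by omega) (by omega) (by omega) (by omega)
    have h2 := card_add_card_nbr_le hQ hcross
    have e2 : (m - 1).choose (k - 1) = (m - 2).choose (k - 2) + (m - 2).choose (k - 1) := by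
      obtain ⟨a, rfl⟩ : ∃ a, m = a + 2 := ⟨m - 2, by omega⟩
      obtain ⟨b, rfl⟩ : ∃ b, k = b + 2 := ⟨k - 2, by omega⟩
      exact Nat.choose_succ_succ _ _
    rw [hZ] at h2
    omega
  have := main Q P hQ hP (fun D hD E hE => by rw [inter_comm]; exact hcross E hE D hD) hQT hQle
  omega

lemma card_eq_sum_pair_subfamilies (F : Finset (Finset ℕ)) (i j : ℕ) :
    F.card = ((F.memberSubfamily i).memberSubfamily j).card +
      ((F.memberSubfamily i).nonMemberSubfamily j).card +
      (((F.nonMemberSubfamily i).memberSubfamily j).card +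
        ((F.nonMemberSubfamily i).nonMemberSubfamily j).card) := by
  simp only [card_memberSubfamily_add_card_nonMemberSubfamily]

lemma card_le_of_pair {V : Finset ℕ} {m k i j : ℕ} {F : Finset (Finset ℕ)}
    (hk : 4 ≤ k) (hm : 2 * k ≤ m) (hV : V.card = m + 1) (hF : F ⊆ V.powersetCard k)
    (hint : ∀ D ∈ F, ∀ E ∈ F, (D ∩ E).Nonempty) (hi : i ∈ V) (hj : j ∈ V) (hij : i ≠ j)
    (hR : ((F.nonMemberSubfamily i).nonMemberSubfamily j).card ≤
      (nbr ((V.erase i).erase j) (k - 2) ((F.nonMemberSubfamily i).nonMemberSubfamily j)).card)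
    (hP : (m - 4).choose (k - 4) ≤ ((F.memberSubfamily i).nonMemberSubfamily j).card)
    (hQ : (m - 4).choose (k - 4) ≤ ((F.nonMemberSubfamily i).memberSubfamily j).card) :
    F.card + (m - 4).choose (k - 1) ≤ m.choose (k - 1) + (m - 4).choose (k - 4) := by
  have hZ : ((V.erase i).erase j).card = m - 1 := by
    rw [card_erase_of_mem (mem_erase.2 ⟨hij.symm, hj⟩), card_erase_of_mem hi, hV]
    omega
  have hF' : F ⊆ V.powersetCard (k - 2 + 1 + 1) := by
    rwa [show k - 2 + 1 + 1 = k by omega]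
  have hF1 := memberSubfamily_subset_powersetCard (x := i) hF'
  have hF0 := nonMemberSubfamily_subset_powersetCard (x := i) hF'
  have hE := card_add_card_nbr_le (𝒟 := (F.nonMemberSubfamily i).nonMemberSubfamily j)
    (memberSubfamily_subset_powersetCard (x := j) hF1) (by
      intro D hD E hE
      simp only [mem_nonMemberSubfamily, mem_memberSubfamily] at hD hE
      obtain ⟨x, hx⟩ := hint D hD.1.1 _ hE.1.1
      simp only [mem_inter, mem_insert] at hx
      rcases hx with ⟨hxD, rfl | rfl | hxE⟩
      · exact absurd hxD hD.1.2
      · exact absurd hxD hD.2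
      · exact ⟨x, mem_inter.2 ⟨hxD, hxE⟩⟩)
  have hPQ := card_add_card_le_of_cross hk hm hZ
    (by simpa [show k - 2 + 1 = k - 1 by omega] using
      nonMemberSubfamily_subset_powersetCard (x := j) hF1)
    (by simpa [show k - 2 + 1 = k - 1 by omega] using
      memberSubfamily_subset_powersetCard (x := j) hF0) (by
      intro D hD E hE
      simp only [mem_nonMemberSubfamily, mem_memberSubfamily] at hD hE
      obtain ⟨x, hx⟩ := hint _ hD.1.1 _ hE.1.1
      simp only [mem_inter, mem_insert] at hx
      rcases hx with ⟨rfl | hxD, rfl | hxE⟩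
      · exact absurd rfl hij
      · exact absurd (mem_insert_of_mem hxE) hE.1.2
      · exact absurd hxD hD.2
      · exact ⟨x, mem_inter.2 ⟨hxD, hxE⟩⟩) hP hQ
  have hsum := card_eq_sum_pair_subfamilies F i j
  rw [hZ] at hE
  have e : m.choose (k - 1) = (m - 1).choose (k - 2) + (m - 1).choose (k - 1) := by
    obtain ⟨a, rfl⟩ : ∃ a, m = a + 1 := ⟨m - 1, by omega⟩
    obtain ⟨b, rfl⟩ : ∃ b, k = b + 2 := ⟨k - 2, by omega⟩
    exact Nat.choose_succ_succ _ _
  omega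

lemma two_mul_choose_le {m k : ℕ} (hk : 4 ≤ k) (hm : 2 * k ≤ m) :
    2 * (m - 4).choose (k - 4) ≤ (m - 2).choose (k - 2) := by
  obtain ⟨a, rfl⟩ : ∃ a, m = a + 4 := ⟨m - 4, by omega⟩
  obtain ⟨b, rfl⟩ : ∃ b, k = b + 4 := ⟨k - 4, by omega⟩
  rw [Nat.add_sub_cancel, Nat.add_sub_cancel, show a + 4 - 2 = a + 1 + 1 by omega,
    show b + 4 - 2 = b + 1 + 1 by omega]
  have e1 := Nat.choose_succ_succ' (a + 1) (b + 1)
  have e2 := Nat.choose_succ_succ' a b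
  have e3 : (a + 1).choose (b + 1) ≤ (a + 1).choose (b + 1 + 1) :=
    choose_le_choose_of_add_le (by omega) (by omega)
  omega

lemma choose_lt_choose_sub_three {m k : ℕ} (hk : 4 ≤ k) (hm : 2 * k ≤ m) :
    (m - 4).choose (k - 4) < (m - 3).choose (k - 2) := by
  obtain ⟨a, rfl⟩ : ∃ a, m = a + 4 := ⟨m - 4, by omega⟩
  obtain ⟨b, rfl⟩ : ∃ b, k = b + 4 := ⟨k - 4, by omega⟩
  rw [Nat.add_sub_cancel, Nat.add_sub_cancel, show a + 4 - 3 = a + 1 by omega,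
    show b + 4 - 2 = b + 1 + 1 by omega]
  have e1 := Nat.choose_succ_succ' a (b + 1)
  have e3 : a.choose b ≤ a.choose (b + 1) :=
    choose_le_choose_of_add_le (by omega) (by omega)
  have e4 : 0 < a.choose (b + 1 + 1) := Nat.choose_pos (by omega)
  omega

/-- The `i`-`j` shift of a single set relative to the family `F`. -/
def shiftSet (F : Finset (Finset ℕ)) (i j : ℕ) (D : Finset ℕ) : Finset ℕ :=
  if j ∈ D ∧ i ∉ D ∧ insert i (D.erase j) ∉ F then insert i (D.erase j) else D

lemma shiftSet_eq_or (F : Finset (Finset ℕ)) (i j : ℕ) (D : Finset ℕ) :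
    (j ∈ D ∧ i ∉ D ∧ insert i (D.erase j) ∉ F ∧ shiftSet F i j D = insert i (D.erase j)) ∨
      ((j ∈ D → i ∉ D → insert i (D.erase j) ∈ F) ∧ shiftSet F i j D = D) := by
  unfold shiftSet
  split_ifs with h
  · exact Or.inl ⟨h.1, h.2.1, h.2.2, rfl⟩
  · refine Or.inr ⟨fun h1 h2 => ?_, rfl⟩
    by_contra h3
    exact h ⟨h1, h2, h3⟩

lemma shiftSet_injOn (F : Finset (Finset ℕ)) (i j : ℕ) : Set.InjOn (shiftSet F i j) F := by
  intro D hD D' hD' h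
  rw [mem_coe] at hD hD'
  rcases shiftSet_eq_or F i j D with ⟨a1, a2, a3, a4⟩ | ⟨a1, a2⟩ <;>
  rcases shiftSet_eq_or F i j D' with ⟨b1, b2, b3, b4⟩ | ⟨b1, b2⟩
  · rw [a4, b4] at h
    have h' := congrArg (fun s => s.erase i) h
    simp only [erase_insert (fun h => a2 (mem_of_mem_erase h)),
      erase_insert (fun h => b2 (mem_of_mem_erase h))] at h'
    rw [← insert_erase a1, h', insert_erase b1]
  · rw [a4, b2] at h
    exact absurd (h ▸ hD') a3
  · rw [a2, b4] at h
    exact absurd (h ▸ hD) b3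
  · rwa [a2, b2] at h

lemma card_shiftSet {F : Finset (Finset ℕ)} {i j : ℕ} (D : Finset ℕ) :
    (shiftSet F i j D).card = D.card := by
  rcases shiftSet_eq_or F i j D with ⟨a1, a2, a3, a4⟩ | ⟨a1, a2⟩
  · rw [a4, card_insert_of_notMem (fun h => a2 (mem_of_mem_erase h)), card_erase_add_one a1]
  · rw [a2]

lemma shiftSet_subset {F : Finset (Finset ℕ)} {V D : Finset ℕ} {i j : ℕ} (hi : i ∈ V)
    (hD : D ⊆ V) : shiftSet F i j D ⊆ V := by
  rcases shiftSet_eq_or F i j D with ⟨a1, a2, a3, a4⟩ | ⟨a1, a2⟩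
  · rw [a4]
    exact insert_subset hi ((erase_subset _ _).trans hD)
  · rwa [a2]

lemma sum_shiftSet_lt_or {F : Finset (Finset ℕ)} {i j : ℕ} (hij : i < j) (D : Finset ℕ) :
    ∑ x ∈ shiftSet F i j D, x ≤ ∑ x ∈ D, x ∧
      (shiftSet F i j D ≠ D → ∑ x ∈ shiftSet F i j D, x < ∑ x ∈ D, x) := by
  rcases shiftSet_eq_or F i j D with ⟨a1, a2, a3, a4⟩ | ⟨a1, a2⟩
  · rw [a4, sum_insert (fun h => a2 (mem_of_mem_erase h))]
    have := add_sum_erase D (fun x => x) a1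
    exact ⟨by omega, fun _ => by omega⟩
  · rw [a2]
    exact ⟨le_rfl, fun h => absurd rfl h⟩

lemma shiftSet_image_intersecting {F : Finset (Finset ℕ)} {i j : ℕ}
    (hint : ∀ D ∈ F, ∀ E ∈ F, (D ∩ E).Nonempty) :
    ∀ D ∈ F.image (shiftSet F i j), ∀ E ∈ F.image (shiftSet F i j), (D ∩ E).Nonempty := by
  have mixed : ∀ D ∈ F, ∀ E ∈ F, j ∈ D → i ∉ D → (j ∈ E → i ∉ E → insert i (E.erase j) ∈ F) →
      (insert i (D.erase j) ∩ E).Nonempty := by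
    intro D hD E hE hjD hiD hE'
    by_cases hiE : i ∈ E
    · exact ⟨i, by simp [hiE]⟩
    by_cases hjE : j ∈ E
    · obtain ⟨x, hx⟩ := hint D hD _ (hE' hjE hiE)
      simp only [mem_inter, mem_insert, mem_erase] at hx
      rcases hx with ⟨hxD, rfl | hx⟩
      · exact absurd hxD hiD
      · exact ⟨x, by simp [hxD, hx]⟩
    · obtain ⟨x, hx⟩ := hint D hD E hE
      rw [mem_inter] at hx
      have : x ≠ j := fun h => hjE (h ▸ hx.2)
      exact ⟨x, by simp [hx, this]⟩
  intro D' hD' E' hE'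
  obtain ⟨D, hD, rfl⟩ := mem_image.1 hD'
  obtain ⟨E, hE, rfl⟩ := mem_image.1 hE'
  rcases shiftSet_eq_or F i j D with ⟨a1, a2, a3, a4⟩ | ⟨a1, a2⟩ <;>
  rcases shiftSet_eq_or F i j E with ⟨b1, b2, b3, b4⟩ | ⟨b1, b2⟩
  · rw [a4, b4]
    exact ⟨i, by simp⟩
  · rw [a4, b2]
    exact mixed D hD E hE a1 a2 b1
  · rw [a2, b4, inter_comm]
    exact mixed E hE D hD b1 b2 a1
  · rw [a2, b2]
    exact hint D hD E hE

lemma exists_min_lt (Y : Finset ℕ) (hY : Y.Nonempty) : ∃ x ∈ Y, ∀ y ∈ Y, y ≠ x → x < y :=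
  ⟨Y.min' hY, Y.min'_mem hY, fun y hy h => lt_of_le_of_ne (Y.min'_le y hy) h.symm⟩

lemma exists_max_gt (Y : Finset ℕ) (hY : Y.Nonempty) : ∃ x ∈ Y, ∀ y ∈ Y, y ≠ x → y < x :=
  ⟨Y.max' hY, Y.max'_mem hY, fun y hy h => lt_of_le_of_ne (Y.le_max' y hy) h⟩

/-- A shifted `2`-intersecting family is no larger than its lower shadow. -/
lemma card_le_card_lowerShadow_of_shifted {Z : Finset ℕ} {N k : ℕ} {R : Finset (Finset ℕ)}
    (hk : 1 ≤ k) (hN : 2 * k ≤ N + 1) (hZ : Z.card = N) (hR : R ⊆ Z.powersetCard k)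
    (hint : ∀ D ∈ R, ∀ E ∈ R, 2 ≤ (D ∩ E).card)
    (hst : ∀ x ∈ Z, ∀ y ∈ Z, x < y → ∀ D ∈ R, y ∈ D → x ∉ D → insert x (D.erase y) ∈ R) :
    R.card ≤ (lowerShadow (k - 1) R).card := by
  have hR' : ∀ D ∈ R, D ⊆ Z ∧ D.card = k := fun D hD => mem_powersetCard.1 (hR hD)
  rcases R.eq_empty_or_nonempty with rfl | ⟨D₀, hD₀⟩
  · simp
  have hkN : k ≤ N := by
    rw [← (hR' D₀ hD₀).2, ← hZ]
    exact card_le_card (hR' D₀ hD₀).1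
  have hcard : (R.image (fun D => Z \ D)).card = R.card := by
    refine card_image_of_injOn fun D hD E hE h => ?_
    rw [← Finset.sdiff_sdiff_eq_self (hR' D hD).1, ← Finset.sdiff_sdiff_eq_self (hR' E hE).1]
    exact congrArg (fun s => Z \ s) h
  have key := card_le_card_nbr_of_compressed (fun x y => y < x) exists_max_gt N Z (N - k) (k - 1)
    (N + 2 - 2 * k) (R.image (fun D => Z \ D)) hZ ?_ ?_ ?_ (by omega) (by omega)
  · rw [hcard] at key
    refine key.trans (card_le_card fun E hE => ?_)
    obtain ⟨⟨hEZ, hEc⟩, C, hC, hCE⟩ := mem_nbr.1 hE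
    obtain ⟨D, hD, rfl⟩ := mem_image.1 hC
    refine mem_lowerShadow.2 ⟨D, hD, fun x hx => ?_, hEc⟩
    by_contra hxD
    exact disjoint_left.1 hCE (mem_sdiff.2 ⟨hEZ hx, hxD⟩) hx
  · intro C hC
    obtain ⟨D, hD, rfl⟩ := mem_image.1 hC
    refine mem_powersetCard.2 ⟨sdiff_subset, ?_⟩
    rw [card_sdiff_of_subset (hR' D hD).1, hZ, (hR' D hD).2]
  · intro C hC C' hC'
    obtain ⟨D, hD, rfl⟩ := mem_image.1 hC
    obtain ⟨E, hE, rfl⟩ := mem_image.1 hC'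
    rw [← sdiff_union_distrib, card_sdiff_of_subset (union_subset (hR' D hD).1 (hR' E hE).1), hZ]
    have h1 := card_union_add_card_inter D E
    have h2 := hint D hD E hE
    rw [(hR' D hD).2, (hR' E hE).2] at h1
    omega
  · intro x hx y hy hyx C hC hyC hxC
    obtain ⟨D, hD, rfl⟩ := mem_image.1 hC
    have hyD : y ∉ D := (mem_sdiff.1 hyC).2
    have hxD : x ∈ D := by
      by_contra h
      exact hxC (mem_sdiff.2 ⟨hx, h⟩)
    refine mem_image.2 ⟨insert y (D.erase x), hst y hy x hx hyx D hD hxD hyD, ?_⟩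
    ext z
    simp only [mem_sdiff, mem_insert, mem_erase, not_or, not_and]
    by_cases hzx : z = x
    · subst hzx
      simp [hx, hyx.ne']
    · simp [hzx]
      tauto

lemma card_le_of_shifted {V : Finset ℕ} {m k i j : ℕ} {F : Finset (Finset ℕ)}
    (hk : 4 ≤ k) (hm : 2 * k ≤ m) (hV : V.card = m + 1) (hF : F ⊆ V.powersetCard k)
    (hint : ∀ D ∈ F, ∀ E ∈ F, (D ∩ E).Nonempty) (hi : i ∈ V) (hj : j ∈ V) (hij : i < j)
    (hmin : ∀ z ∈ V, z ≠ i → z ≠ j → j < z)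
    (hst : ∀ x ∈ V, ∀ y ∈ V, x < y → ∀ D ∈ F, y ∈ D → x ∉ D → insert x (D.erase y) ∈ F)
    (hT : (m - 4).choose (k - 4) ≤ ((F.nonMemberSubfamily i).nonMemberSubfamily j).card) :
    F.card + (m - 4).choose (k - 1) ≤ m.choose (k - 1) + (m - 4).choose (k - 4) := by
  set R := (F.nonMemberSubfamily i).nonMemberSubfamily j with hRdef
  have hR : ∀ D, D ∈ R ↔ D ∈ F ∧ i ∉ D ∧ j ∉ D := by
    intro D
    rw [hRdef, mem_nonMemberSubfamily, mem_nonMemberSubfamily, and_assoc]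
  have hZ : ((V.erase i).erase j).card = m - 1 := by
    rw [card_erase_of_mem (mem_erase.2 ⟨hij.ne', hj⟩), card_erase_of_mem hi, hV]
    omega
  have hRsub : R ⊆ ((V.erase i).erase j).powersetCard k :=
    nonMemberSubfamily_subset_powersetCard (nonMemberSubfamily_subset_powersetCard hF)
  have hlt : ∀ z ∈ (V.erase i).erase j, j < z := fun z hz => by
    simp only [mem_erase] at hz
    exact hmin z hz.2.2 hz.2.1 hz.1
  have hRZ : ∀ D ∈ R, D ⊆ (V.erase i).erase j := fun D hD => (mem_powersetCard.1 (hRsub hD)).1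
  have hR2 : ∀ D ∈ R, ∀ E ∈ R, 2 ≤ (D ∩ E).card := by
    intro D hD E hE
    obtain ⟨x, hx⟩ := hint D ((hR D).1 hD).1 E ((hR E).1 hE).1
    have hxD := (mem_inter.1 hx).1
    have hxZ := hRZ D hD hxD
    have hxV : x ∈ V := mem_of_mem_erase (mem_of_mem_erase hxZ)
    obtain ⟨y, hy⟩ := hint _ (hst i hi x hxV (hij.trans (hlt x hxZ)) D ((hR D).1 hD).1 hxD
      ((hR D).1 hD).2.1) E ((hR E).1 hE).1
    simp only [mem_inter, mem_insert, mem_erase] at hy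
    rcases hy with ⟨rfl | hy, hyE⟩
    · exact absurd hyE ((hR E).1 hE).2.1
    · exact one_lt_card.2 ⟨x, hx, y, mem_inter.2 ⟨hy.2, hyE⟩, hy.1.symm⟩
  have hRst : ∀ x ∈ (V.erase i).erase j, ∀ y ∈ (V.erase i).erase j, x < y → ∀ D ∈ R, y ∈ D →
      x ∉ D → insert x (D.erase y) ∈ R := by
    intro x hx y hy hxy D hD hyD hxD
    simp only [mem_erase] at hx hy
    obtain ⟨h1, h2, h3⟩ := (hR D).1 hD
    refine (hR _).2 ⟨hst x hx.2.2 y hy.2.2 hxy D h1 hyD hxD, ?_, ?_⟩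
    · simp [hx.2.1.symm, h2]
    · simp [hx.1.symm, h3]
  have hnbr := card_le_card_nbr_of_compressed (· < ·) exists_min_lt (m - 1) _ k (k - 2) 2 R hZ
    hRsub hR2 hRst (by omega) (by omega)
  have hsh := card_le_card_lowerShadow_of_shifted (by omega) (by omega) hZ hRsub hR2 hRst
  have hshadow : ∀ S ∈ lowerShadow (k - 1) R, ∃ D ∈ R, ∃ y ∈ D, S = D.erase y := by
    intro S hS
    obtain ⟨D, hD, hSD, hSc⟩ := mem_lowerShadow.1 hS
    have hDc := (mem_powersetCard.1 (hRsub hD)).2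
    obtain ⟨y, hy⟩ : (D \ S).Nonempty := by
      rw [← card_pos, card_sdiff_of_subset hSD]
      omega
    rw [mem_sdiff] at hy
    refine ⟨D, hD, y, hy.1, eq_of_subset_of_card_le (subset_erase.2 ⟨hSD, hy.2⟩) ?_⟩
    rw [card_erase_of_mem hy.1, hDc, hSc]
  refine card_le_of_pair hk hm hV hF hint hi hj hij.ne hnbr (hT.trans (hsh.trans (card_le_card ?_)))
    (hT.trans (hsh.trans (card_le_card ?_)))
  · intro S hS
    obtain ⟨D, hD, y, hy, rfl⟩ := hshadow S hS
    obtain ⟨h1, h2, h3⟩ := (hR D).1 hD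
    have hyZ := hRZ D hD hy
    simp only [mem_nonMemberSubfamily, mem_memberSubfamily]
    exact ⟨⟨hst i hi y (mem_of_mem_erase (mem_of_mem_erase hyZ)) (hij.trans (hlt y hyZ)) D h1 hy h2,
      fun h => h2 (mem_of_mem_erase h)⟩, fun h => h3 (mem_of_mem_erase h)⟩
  · intro S hS
    obtain ⟨D, hD, y, hy, rfl⟩ := hshadow S hS
    obtain ⟨h1, h2, h3⟩ := (hR D).1 hD
    have hyZ := hRZ D hD hy
    simp only [mem_nonMemberSubfamily, mem_memberSubfamily]
    refine ⟨⟨hst j hj y (mem_of_mem_erase (mem_of_mem_erase hyZ)) (hlt y hyZ) D h1 hy h3, ?_⟩,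
      fun h => h3 (mem_of_mem_erase h)⟩
    simp [hij.ne, h2]

/-- Frankl's degree theorem: every intersecting family in which each point is missed by at least
`C(n-5,k-4)` members has bounded size (here `n = m + 1`). -/
lemma card_le_of_forall_card_nonMemberSubfamily {V : Finset ℕ} {m k : ℕ} (hk : 4 ≤ k)
    (hm : 2 * k ≤ m) (hV : V.card = m + 1) (w : ℕ) :
    ∀ F : Finset (Finset ℕ), ∑ D ∈ F, ∑ x ∈ D, x = w → F ⊆ V.powersetCard k →
      (∀ D ∈ F, ∀ E ∈ F, (D ∩ E).Nonempty) →
      (∀ i ∈ V, (m - 4).choose (k - 4) ≤ (F.nonMemberSubfamily i).card) →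
      F.card + (m - 4).choose (k - 1) ≤ m.choose (k - 1) + (m - 4).choose (k - 4) := by
  induction w using Nat.strong_induction_on with
  | _ w ih =>
  intro F hw hF hint hdeg
  by_cases ha : ∃ i ∈ V, (F.nonMemberSubfamily i).card ≤ (m - 2).choose (k - 2)
  · obtain ⟨i, hi, hle⟩ := ha
    have hVi : (V.erase i).card = m := by rw [card_erase_of_mem hi]; omega
    have h1 := card_add_choose_le_card_nbr (p := k) hk hm (by omega) (by omega)
      (nonMemberSubfamily_subset_powersetCard (x := i) hF) (hdeg i hi) hle
    have h2 := card_add_card_nbr_le (𝒟 := F.nonMemberSubfamily i)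
      (memberSubfamily_subset_powersetCard (p := k - 1) (x := i) (𝒟 := F)
        (by rwa [Nat.sub_add_cancel (by omega)])) (by
        intro D hD E hE
        rw [mem_nonMemberSubfamily] at hD
        rw [mem_memberSubfamily] at hE
        obtain ⟨x, hx⟩ := hint D hD.1 _ hE.1
        simp only [mem_inter, mem_insert] at hx
        rcases hx with ⟨hxD, rfl | hxE⟩
        · exact absurd hxD hD.2
        · exact ⟨x, mem_inter.2 ⟨hxD, hxE⟩⟩)
    have h3 := card_memberSubfamily_add_card_nonMemberSubfamily i F
    rw [hVi] at h2
    omega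
  push Not at ha
  by_cases hb : ∃ i ∈ V, ∃ j ∈ V, i ≠ j ∧
      ((F.nonMemberSubfamily i).nonMemberSubfamily j).card ≤ (m - 4).choose (k - 4)
  · obtain ⟨i, hi, j, hj, hij, hle⟩ := hb
    have h2 := two_mul_choose_le hk hm
    have hZ : ((V.erase i).erase j).card = m - 1 := by
      rw [card_erase_of_mem (mem_erase.2 ⟨hij.symm, hj⟩), card_erase_of_mem hi, hV]
      omega
    refine card_le_of_pair hk hm hV hF hint hi hj hij ?_ ?_ ?_
    · rcases Nat.eq_zero_or_pos ((F.nonMemberSubfamily i).nonMemberSubfamily j).card with h0 | h0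
      · rw [h0]
        exact Nat.zero_le _
      · refine (card_lt_card_nbr (p := k) (c := m - 1 - k) (by omega)
          (nonMemberSubfamily_subset_powersetCard (nonMemberSubfamily_subset_powersetCard hF))
          (by omega) h0 (hle.trans_lt ?_)).le
        rw [show m - 1 - k + (k - 2) = m - 3 by omega]
        exact choose_lt_choose_sub_three hk hm
    · have h3 := card_memberSubfamily_add_card_nonMemberSubfamily i (F.nonMemberSubfamily j)
      have e1 : (F.nonMemberSubfamily j).memberSubfamily i =
          (F.memberSubfamily i).nonMemberSubfamily j := by
        ext D
        simp only [mem_nonMemberSubfamily, mem_memberSubfamily, mem_insert, not_or]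
        exact ⟨fun h => ⟨⟨h.1.1, h.2⟩, h.1.2.2⟩, fun h => ⟨⟨h.1.1, hij.symm, h.2⟩, h.1.2⟩⟩
      have e2 : (F.nonMemberSubfamily j).nonMemberSubfamily i =
          (F.nonMemberSubfamily i).nonMemberSubfamily j := by
        ext D
        simp only [mem_nonMemberSubfamily]
        tauto
      have h4 := ha j hj
      rw [e1, e2] at h3
      omega
    · have h3 := card_memberSubfamily_add_card_nonMemberSubfamily j (F.nonMemberSubfamily i)
      have h4 := ha i hi
      omega
  push Not at hb
  by_cases hc : ∃ i ∈ V, ∃ j ∈ V, i < j ∧ ∃ D ∈ F, j ∈ D ∧ i ∉ D ∧ insert i (D.erase j) ∉ F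
  · obtain ⟨i, hi, j, hj, hij, D₀, hD₀, hjD, hiD, hnot⟩ := hc
    have hcard : (F.image (shiftSet F i j)).card = F.card :=
      card_image_of_injOn (shiftSet_injOn F i j)
    rw [← hcard]
    refine ih _ ?_ _ rfl ?_ (shiftSet_image_intersecting hint) ?_
    · rw [← hw, sum_image (shiftSet_injOn F i j)]
      refine sum_lt_sum (fun D _ => (sum_shiftSet_lt_or hij D).1)
        ⟨D₀, hD₀, (sum_shiftSet_lt_or hij D₀).2 ?_⟩
      rw [shiftSet, if_pos ⟨hjD, hiD, hnot⟩]
      intro h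
      exact hiD (h ▸ mem_insert_self _ _)
    · intro D' hD'
      obtain ⟨D, hD, rfl⟩ := mem_image.1 hD'
      have := mem_powersetCard.1 (hF hD)
      exact mem_powersetCard.2 ⟨shiftSet_subset hi this.1, by rw [card_shiftSet, this.2]⟩
    · have aux : ∀ x ∈ V, ∀ y ∈ V, x ≠ y → (x = j ∨ y = j) →
          (m - 4).choose (k - 4) ≤ ((F.image (shiftSet F i j)).nonMemberSubfamily x).card := by
        intro x hx y hy hxy hor
        refine (hb x hx y hy hxy).le.trans (card_le_card fun D hD => ?_)
        simp only [mem_nonMemberSubfamily] at hD ⊢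
        have hjD' : j ∉ D := by
          rcases hor with rfl | rfl
          · exact hD.1.2
          · exact hD.2
        exact ⟨mem_image.2 ⟨D, hD.1.1, if_neg fun h => hjD' h.1⟩, hD.1.2⟩
      intro x hx
      by_cases hxj : x = j
      · exact aux x hx i hi (by omega) (Or.inl hxj)
      · exact aux x hx j hj hxj (Or.inr rfl)
  push Not at hc
  obtain ⟨i, hi, hi'⟩ := exists_min_lt V (card_pos.1 (by omega))
  obtain ⟨j, hj, hj'⟩ := exists_min_lt (V.erase i)
    (card_pos.1 (by rw [card_erase_of_mem hi]; omega))
  have hjV := mem_of_mem_erase hj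
  have hji := ne_of_mem_erase hj
  exact card_le_of_shifted hk hm hV hF hint hi hjV (hi' j hjV hji)
    (fun z hz h1 h2 => hj' z (mem_erase.2 ⟨h1, hz⟩) h2) hc (hb i hi j hjV hji.symm).le

/-- Two pairs of sets with the same intersection pattern are related by a permutation. -/
lemma exists_perm_of_card_eq {X A B A' B' : Finset ℕ} (hA : A ⊆ X) (hB : B ⊆ X) (hA' : A' ⊆ X)
    (hB' : B' ⊆ X) (h1 : A.card = A'.card) (h2 : B.card = B'.card)
    (h3 : (A ∩ B).card = (A' ∩ B').card) :
    ∃ σ : Equiv.Perm ℕ, (∀ x, x ∉ X → σ x = x) ∧ (∀ x, σ x ∈ A' ↔ x ∈ A) ∧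
      (∀ x, σ x ∈ B' ↔ x ∈ B) := by
  classical
  let col : Finset ℕ → Finset ℕ → ℕ → (Bool × Bool) ⊕ ℕ := fun A B x =>
    if x ∈ X then Sum.inl (decide (x ∈ A), decide (x ∈ B)) else Sum.inr x
  have hinl : ∀ A B x b, col A B x = Sum.inl b ↔
      x ∈ X ∧ (decide (x ∈ A), decide (x ∈ B)) = b := by
    intro A B x b
    by_cases h : x ∈ X <;> simp [col, h]
  have hinr : ∀ A B x y, col A B x = Sum.inr y ↔ x ∉ X ∧ x = y := by
    intro A B x b
    by_cases h : x ∈ X <;> simp [col, h]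
  have hcount : ∀ A B : Finset ℕ, A ⊆ X → B ⊆ X → ∀ b : Bool × Bool,
      (X.filter (fun x => (decide (x ∈ A), decide (x ∈ B)) = b)).card =
        match b with
        | (true, true) => (A ∩ B).card
        | (true, false) => A.card - (A ∩ B).card
        | (false, true) => B.card - (A ∩ B).card
        | (false, false) => X.card - (A.card + B.card - (A ∩ B).card) := by
    rintro A B hA hB ⟨_ | _, _ | _⟩
    · have : X.filter (fun x => (decide (x ∈ A), decide (x ∈ B)) = (false, false)) =
          X \ (A ∪ B) := by
        ext x; simp
      rw [this, card_sdiff_of_subset (union_subset hA hB), card_union]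
    · have : X.filter (fun x => (decide (x ∈ A), decide (x ∈ B)) = (false, true)) = B \ A := by
        ext x
        simp only [mem_filter, Prod.mk.injEq, decide_eq_false_iff_not, decide_eq_true_eq, mem_sdiff]
        exact ⟨fun h => ⟨h.2.2, h.2.1⟩, fun h => ⟨hB h.1, h.2, h.1⟩⟩
      rw [this, card_sdiff]
    · have : X.filter (fun x => (decide (x ∈ A), decide (x ∈ B)) = (true, false)) = A \ B := by
        ext x
        simp only [mem_filter, Prod.mk.injEq, decide_eq_false_iff_not, decide_eq_true_eq, mem_sdiff]
        exact ⟨fun h => h.2, fun h => ⟨hA h.1, h⟩⟩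
      rw [this, card_sdiff, inter_comm]
    · have : X.filter (fun x => (decide (x ∈ A), decide (x ∈ B)) = (true, true)) = A ∩ B := by
        ext x
        simp only [mem_filter, Prod.mk.injEq, decide_eq_true_eq, mem_inter]
        exact ⟨fun h => h.2, fun h => ⟨hA h.1, h⟩⟩
      rw [this]
  have hfib : ∀ c, Nonempty ({x // col A B x = c} ≃ {x // col A' B' x = c}) := by
    rintro (b | y)
    · have hmem : ∀ A B x, col A B x = Sum.inl b ↔
          x ∈ X.filter (fun x => (decide (x ∈ A), decide (x ∈ B)) = b) := by
        intro A B x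
        rw [hinl, mem_filter]
      refine ⟨(Equiv.subtypeEquivRight (hmem A B)).trans ((equivOfCardEq ?_).trans
        (Equiv.subtypeEquivRight (hmem A' B')).symm)⟩
      rw [hcount A B hA hB, hcount A' B' hA' hB', h1, h2, h3]
    · exact ⟨Equiv.subtypeEquivRight fun x => (hinr A B x y).trans (hinr A' B' x y).symm⟩
  refine ⟨Equiv.ofFiberEquiv fun c => (hfib c).some, ?_⟩
  set σ := Equiv.ofFiberEquiv fun c => (hfib c).some
  have hσ : ∀ x, col A' B' (σ x) = col A B x := fun x => Equiv.ofFiberEquiv_map _ x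
  have hout : ∀ x, x ∉ X → σ x = x := fun x hx =>
    ((hinr A' B' (σ x) x).1 ((hσ x).trans ((hinr A B x x).2 ⟨hx, rfl⟩))).2
  have hin : ∀ x ∈ X, σ x ∈ X ∧ (decide (σ x ∈ A'), decide (σ x ∈ B')) =
      (decide (x ∈ A), decide (x ∈ B)) := fun x hx =>
    (hinl A' B' (σ x) _).1 ((hσ x).trans ((hinl A B x _).2 ⟨hx, rfl⟩))
  refine ⟨hout, fun x => ?_, fun x => ?_⟩
  · by_cases hx : x ∈ X
    · simpa using congrArg Prod.fst (hin x hx).2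
    · rw [hout x hx]
      exact ⟨fun h => absurd (hA' h) hx, fun h => absurd (hA h) hx⟩
  · by_cases hx : x ∈ X
    · simpa using congrArg Prod.snd (hin x hx).2
    · rw [hout x hx]
      exact ⟨fun h => absurd (hB' h) hx, fun h => absurd (hB h) hx⟩

/-- The maximal intersecting family whose members avoiding `1` are exactly `A` and `B`. -/
def pairFam (n k : ℕ) (A B : Finset ℕ) : Finset (Finset ℕ) :=
  {A, B} ∪ ((Icc 1 n).powersetCard k).filter
    (fun D => 1 ∈ D ∧ (D ∩ A).Nonempty ∧ (D ∩ B).Nonempty)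

lemma mem_pairFam {n k : ℕ} {A B D : Finset ℕ} :
    D ∈ pairFam n k A B ↔ (D = A ∨ D = B) ∨ (D ⊆ Icc 1 n ∧ D.card = k) ∧
      1 ∈ D ∧ (D ∩ A).Nonempty ∧ (D ∩ B).Nonempty := by
  simp only [pairFam, mem_union, mem_insert, mem_singleton, mem_filter, mem_powersetCard]

lemma image_perm_eq {σ : Equiv.Perm ℕ} {S S' : Finset ℕ} (h : ∀ x, σ x ∈ S' ↔ x ∈ S) :
    S.image σ = S' := by
  ext y
  rw [mem_image]
  constructor
  · rintro ⟨x, hx, rfl⟩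
    exact (h x).2 hx
  · intro hy
    exact ⟨σ.symm y, (h _).1 (by simpa using hy), by simp⟩

lemma pairFam_image {n k : ℕ} {A B A' B' : Finset ℕ} {σ : Equiv.Perm ℕ}
    (h1 : σ 1 = 1) (hn : ∀ x, σ x ∈ Icc 1 n ↔ x ∈ Icc 1 n) (hA : ∀ x, σ x ∈ A' ↔ x ∈ A)
    (hB : ∀ x, σ x ∈ B' ↔ x ∈ B) :
    (pairFam n k A B).image (fun D => D.image σ) = pairFam n k A' B' := by
  have hne : ∀ S S' : Finset ℕ, (∀ x, σ x ∈ S' ↔ x ∈ S) → ∀ D : Finset ℕ,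
      (D.image σ ∩ S').Nonempty ↔ (D ∩ S).Nonempty := by
    intro S S' h D
    rw [← image_perm_eq h, ← image_inter _ _ σ.injective, image_nonempty]
  have hmem : ∀ D, D.image σ ∈ pairFam n k A' B' ↔ D ∈ pairFam n k A B := by
    intro D
    rw [mem_pairFam, mem_pairFam, hne A A' hA, hne B B' hB, card_image_of_injective _ σ.injective]
    have e1 : D.image σ = A' ↔ D = A := by
      rw [← image_perm_eq hA]
      exact (image_injective σ.injective).eq_iff
    have e2 : D.image σ = B' ↔ D = B := by
      rw [← image_perm_eq hB]
      exact (image_injective σ.injective).eq_iff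
    have e3 : D.image σ ⊆ Icc 1 n ↔ D ⊆ Icc 1 n := by
      simpa only [image_perm_eq hn] using image_subset_image_iff (s := D) (t := Icc 1 n) σ.injective
    have e4 : 1 ∈ D.image σ ↔ 1 ∈ D := by
      conv_lhs => rw [← h1]
      exact σ.injective.mem_finset_image
    rw [e1, e2, e3, e4]
  ext E
  rw [mem_image]
  constructor
  · rintro ⟨D, hD, rfl⟩
    exact (hmem D).2 hD
  · intro hE
    have hE' : (E.image σ.symm).image σ = E := by
      rw [image_image]
      simp
    exact ⟨E.image σ.symm, (hmem _).1 (by rwa [hE']), hE'⟩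

lemma card_pairFam_add_card_nbr {n k : ℕ} {A B : Finset ℕ} (hk : 1 ≤ k) (hn : 1 ≤ n) (hAB : A ≠ B)
    (hA : A ⊆ Icc 2 n) (hB : B ⊆ Icc 2 n) :
    (pairFam n k A B).card + (nbr (Icc 2 n) (k - 1) {A, B}).card = 2 + (n - 1).choose (k - 1) := by
  have h1 : (1 : ℕ) ∉ Icc 2 n := by simp
  have hA1 : 1 ∉ A := fun h => h1 (hA h)
  have hB1 : 1 ∉ B := fun h => h1 (hB h)
  have hIcc : insert 1 (Icc 2 n) = Icc 1 n := by
    ext x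
    simp only [mem_insert, mem_Icc]
    omega
  have hnon : (pairFam n k A B).nonMemberSubfamily 1 = {A, B} := by
    ext D
    rw [mem_nonMemberSubfamily, mem_pairFam, mem_insert, mem_singleton]
    constructor
    · rintro ⟨h | h, h'⟩
      · exact h
      · exact absurd h.2.1 h'
    · rintro (rfl | rfl)
      · exact ⟨Or.inl (Or.inl rfl), hA1⟩
      · exact ⟨Or.inl (Or.inr rfl), hB1⟩
  have hins : ∀ D S : Finset ℕ, 1 ∉ S → ((insert 1 D ∩ S).Nonempty ↔ ¬ Disjoint S D) := by
    intro D S hS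
    rw [insert_inter_of_notMem hS, disjoint_comm, not_disjoint_iff_nonempty_inter]
  have hmem : (pairFam n k A B).memberSubfamily 1 =
      (Icc 2 n).powersetCard (k - 1) \ nbr (Icc 2 n) (k - 1) {A, B} := by
    ext D
    rw [mem_memberSubfamily, mem_pairFam, hins D A hA1, hins D B hB1, mem_sdiff, mem_nbr,
      mem_powersetCard, ← hIcc]
    simp only [mem_insert, mem_singleton, exists_eq_or_imp, exists_eq_left]
    constructor
    · rintro ⟨h | h, h'⟩
      · exfalso
        rcases h with h | h
        · exact hA1 (h ▸ mem_insert_self _ _)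
        · exact hB1 (h ▸ mem_insert_self _ _)
      · rw [insert_subset_insert_iff h', card_insert_of_notMem h'] at h
        have : D.card = k - 1 := by omega
        tauto
    · rintro ⟨h, h'⟩
      have h1D : 1 ∉ D := fun hh => h1 (h.1 hh)
      rw [insert_subset_insert_iff h1D, card_insert_of_notMem h1D]
      have : D.card + 1 = k := by omega
      tauto
  have hsum := card_memberSubfamily_add_card_nonMemberSubfamily 1 (pairFam n k A B)
  rw [hmem, hnon, card_pair hAB] at hsum
  have hsub : nbr (Icc 2 n) (k - 1) {A, B} ⊆ (Icc 2 n).powersetCard (k - 1) := filter_subset _ _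
  have h2 := card_sdiff_add_card_eq_card hsub
  have h3 : (Icc 2 n).card = n - 1 := by
    rw [Nat.card_Icc]
    omega
  rw [card_powersetCard, h3] at h2
  omega

lemma card_nbr_pair_add_choose_lt {k m : ℕ} {X A B : Finset ℕ} (hk : 5 ≤ k) (hm : 2 * k ≤ m)
    (hX : X.card = m) (hA : A ∈ X.powersetCard k) (hB : B ∈ X.powersetCard k) (hAB : A ≠ B)
    (h4 : 4 ≤ (A ∩ B).card) :
    (nbr X (k - 1) {A, B}).card + (m - 4).choose (k - 4) < (m - 4).choose (k - 1) + 2 := by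
  obtain ⟨I, hI, hI4⟩ := exists_subset_card_eq h4
  have hIA : I ⊆ A := hI.trans inter_subset_left
  have hIB : I ⊆ B := hI.trans inter_subset_right
  have hIX : I ⊆ X := hIA.trans (mem_powersetCard.1 hA).1
  have hXI : (X \ I).card = m - 4 := by rw [card_sdiff_of_subset hIX, hX, hI4]
  set 𝒢 := ((X \ I).powersetCard (k - 4)).image (· ∪ I) with h𝒢
  have hmem : ∀ D ∈ X.powersetCard k, I ⊆ D → D ∈ 𝒢 := by
    intro D hD hID
    rw [mem_powersetCard] at hD
    refine mem_image.2 ⟨D \ I, mem_powersetCard.2 ⟨sdiff_subset_sdiff hD.1 le_rfl, ?_⟩,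
      sdiff_union_of_subset hID⟩
    rw [card_sdiff_of_subset hID, hI4, hD.2]
  have hdisj : ∀ D ∈ (X \ I).powersetCard (k - 4), Disjoint D I := fun D hD =>
    disjoint_of_subset_left (mem_powersetCard.1 hD).1 sdiff_disjoint
  have hcard : 𝒢.card = (m - 4).choose (k - 4) := by
    rw [h𝒢, card_image_of_injOn, card_powersetCard, hXI]
    intro D hD E hE hDE
    have := congrArg (· \ I) hDE
    simpa only [union_sdiff_cancel_right (hdisj D hD), union_sdiff_cancel_right (hdisj E hE)]
      using this
  have hsub : 𝒢 ⊆ X.powersetCard k := by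
    intro D hD
    obtain ⟨E, hE, rfl⟩ := mem_image.1 hD
    have hE' := mem_powersetCard.1 hE
    rw [mem_powersetCard, card_union_of_disjoint (hdisj E hE), hE'.2, hI4]
    exact ⟨union_subset (hE'.1.trans sdiff_subset) hIX, by omega⟩
  have h2 : 2 < 𝒢.card := by
    have := choose_le_choose_of_add_le (M := m - 4) (a := 1) (b := k - 4) (by omega) (by omega)
    rw [Nat.choose_one_right] at this
    omega
  have hnbr : (nbr X (k - 1) 𝒢).card ≤ (m - 4).choose (k - 1) := by
    rw [← hXI, ← card_powersetCard]
    refine card_le_card fun E hE => ?_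
    obtain ⟨⟨hEX, hE⟩, D, hD, hDE⟩ := mem_nbr.1 hE
    obtain ⟨D', -, rfl⟩ := mem_image.1 hD
    exact mem_powersetCard.2 ⟨subset_sdiff.2 ⟨hEX, (disjoint_of_subset_left
      subset_union_right hDE).symm⟩, hE⟩
  have := card_nbr_pair_lt hk hm hX hsub (hmem A hA hIA) (hmem B hB hIB) hAB h2 hcard.le
  omega

lemma card_add_card_nbr_nonMemberSubfamily_le {n k : ℕ} {F : Finset (Finset ℕ)} (hk : 1 ≤ k)
    (hn : 1 ≤ n) (hF : F ⊆ (Icc 1 n).powersetCard k) (hint : ∀ D ∈ F, ∀ E ∈ F, (D ∩ E).Nonempty) :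
    F.card + (nbr (Icc 2 n) (k - 1) (F.nonMemberSubfamily 1)).card ≤
      (F.nonMemberSubfamily 1).card + (n - 1).choose (k - 1) := by
  have hIcc : (Icc 1 n).erase 1 = Icc 2 n := by
    ext x
    simp only [mem_erase, mem_Icc]
    omega
  have hH := memberSubfamily_subset_powersetCard (p := k - 1) (x := 1) (𝒟 := F)
    (by rwa [Nat.sub_add_cancel hk])
  rw [hIcc] at hH
  have h1 := card_add_card_nbr_le (𝒟 := F.nonMemberSubfamily 1) hH (by
    intro D hD E hE
    rw [mem_nonMemberSubfamily] at hD
    rw [mem_memberSubfamily] at hE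
    obtain ⟨x, hx⟩ := hint D hD.1 _ hE.1
    simp only [mem_inter, mem_insert] at hx
    rcases hx with ⟨hxD, rfl | hxE⟩
    · exact absurd hxD hD.2
    · exact ⟨x, mem_inter.2 ⟨hxD, hxE⟩⟩)
  have h2 : (Icc 2 n).card = n - 1 := by
    rw [Nat.card_Icc]
    omega
  have h3 := card_memberSubfamily_add_card_nonMemberSubfamily 1 F
  rw [h2] at h1
  omega

lemma subset_pairFam {n k : ℕ} {A B : Finset ℕ} {F : Finset (Finset ℕ)}
    (hF : F ⊆ (Icc 1 n).powersetCard k) (hint : ∀ D ∈ F, ∀ E ∈ F, (D ∩ E).Nonempty) (hA : A ∈ F)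
    (hB : B ∈ F) (h : F.nonMemberSubfamily 1 ⊆ {A, B}) : F ⊆ pairFam n k A B := by
  intro D hD
  rw [mem_pairFam]
  by_cases h1 : 1 ∈ D
  · exact Or.inr ⟨mem_powersetCard.1 (hF hD), h1, hint D hD A hA, hint D hD B hB⟩
  · have := h (mem_nonMemberSubfamily.2 ⟨hD, h1⟩)
    rw [mem_insert, mem_singleton] at this
    exact Or.inl this

/-- the special case of Theorem `thmclass2` for two sets with given
intersection size. -/
theorem statement13 (n k s : ℕ) (hk : 4 ≤ k) (hn : 2 * k < n)
    (hs2 : 2 ≤ s) (hsk : s ≤ k)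
    (F : Finset (Finset ℕ)) (hF : F ⊆ (Finset.Icc 1 n).powersetCard k)
    (hint : IntersectingFam F) (hmax : maxDeg n F = famDeg F 1)
    (A B : Finset ℕ) (hA : A ∈ F) (hB : B ∈ F) (hA1 : 1 ∉ A) (hB1 : 1 ∉ B)
    (hAB : (A ∩ B).card = k - s + 1)
    (hcond : 4 ≤ k - s + 1 ∨ diversity n F ≤ Nat.choose (n - 5) (k - 4)) :
    F.card ≤ (Jfam n k s).card ∧
    (F.card = (Jfam n k s).card → IsomorphicFam n F (Jfam n k s)) := by
  have h1X : (1 : ℕ) ∉ Icc 2 n := by simp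
  have hX : (Icc 2 n).card = n - 1 := by
    rw [Nat.card_Icc]
    omega
  have herase : (Icc 1 n).erase 1 = Icc 2 n := by
    ext x
    simp only [mem_erase, mem_Icc]
    omega
  have hne : A ≠ B := by
    rintro rfl
    rw [inter_self, (mem_powersetCard.1 (hF hA)).2] at hAB
    omega
  have hG := nonMemberSubfamily_subset_powersetCard (x := 1) hF
  rw [herase] at hG
  have hAG : A ∈ F.nonMemberSubfamily 1 := mem_nonMemberSubfamily.2 ⟨hA, hA1⟩
  have hBG : B ∈ F.nonMemberSubfamily 1 := mem_nonMemberSubfamily.2 ⟨hB, hB1⟩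
  obtain ⟨hAX, hAk⟩ := mem_powersetCard.1 (hG hAG)
  obtain ⟨hBX, hBk⟩ := mem_powersetCard.1 (hG hBG)
  have hdeg : ∀ i, famDeg F i + (F.nonMemberSubfamily i).card = F.card := fun i =>
    card_filter_add_card_filter_not _
  have hdeg_le : ∀ i ∈ Icc 1 n, (F.nonMemberSubfamily 1).card ≤ (F.nonMemberSubfamily i).card := by
    intro i hi
    have h1 : famDeg F i ≤ maxDeg n F := le_sup hi
    have h2 := hdeg i
    have h3 := hdeg 1
    omega
  have hdiv : diversity n F = (F.nonMemberSubfamily 1).card := by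
    have := hdeg 1
    rw [diversity, hmax]
    omega
  rw [hdiv] at hcond
  have hinter : Icc 2 (k + 1) ∩ Icc (s + 1) (k + s) = Icc (s + 1) (k + 1) := by
    ext x
    simp only [mem_inter, mem_Icc]
    omega
  obtain ⟨σ, hσ, hσA, hσB⟩ := exists_perm_of_card_eq (A' := Icc 2 (k + 1))
    (B' := Icc (s + 1) (k + s)) hAX hBX (Icc_subset_Icc le_rfl (by omega))
    (Icc_subset_Icc (by omega) (by omega)) (by rw [hAk, Nat.card_Icc]; omega)
    (by rw [hBk, Nat.card_Icc]; omega) (by rw [hAB, hinter, Nat.card_Icc]; omega)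
  have hσn : ∀ x, σ x ∈ Icc 1 n ↔ x ∈ Icc 1 n := by
    intro x
    by_cases hx : x ∈ Icc 2 n
    · have hσx : σ x ∈ Icc 2 n := by
        by_contra h
        exact h (by rwa [σ.injective (hσ _ h)])
      simp only [mem_Icc] at hx hσx ⊢
      omega
    · rw [hσ x hx]
  have himage : (pairFam n k A B).image (fun D => D.image σ) = Jfam n k s :=
    pairFam_image (hσ 1 h1X) hσn hσA hσB
  have hJ : (Jfam n k s).card = (pairFam n k A B).card := by
    rw [← himage, card_image_of_injective _ (image_injective σ.injective)]
  have hpair := card_pairFam_add_card_nbr (k := k) (by omega) (by omega) hne hAX hBX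
  rw [hJ]
  suffices h : F ⊆ pairFam n k A B ∨ F.card < (pairFam n k A B).card by
    rcases h with h | h
    · exact ⟨card_le_card h, fun h' =>
        ⟨σ, image_perm_eq hσn, by rw [eq_of_subset_of_card_le h h'.ge, himage]⟩⟩
    · exact ⟨h.le, fun h' => absurd h' h.ne⟩
  have hsub : ({A, B} : Finset (Finset ℕ)) ⊆ F.nonMemberSubfamily 1 := by
    simp [insert_subset_iff, hAG, hBG]
  have h4 : n - 5 = n - 1 - 4 := by omega
  rw [h4] at hcond
  rcases le_or_gt (F.nonMemberSubfamily 1).card ((n - 1 - 4).choose (k - 4)) with hle | hgt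
  · rcases (card_le_card hsub).eq_or_lt with h2 | h2
    · exact Or.inl (subset_pairFam hF hint hA hB (eq_of_subset_of_card_le hsub h2.ge).ge)
    · rw [card_pair hne] at h2
      have hk5 : 5 ≤ k := by
        rcases hk.eq_or_lt with rfl | hk5
        · rw [Nat.sub_self, Nat.choose_zero_right] at hle
          omega
        · exact hk5
      have h3 := card_nbr_pair_lt hk5 (by omega) hX hG hAG hBG hne h2 hle
      have h5 := card_add_card_nbr_nonMemberSubfamily_le (by omega) (by omega) hF hint
      omega
  · have hks : 4 ≤ k - s + 1 := hcond.resolve_right (by omega)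
    have h3 := card_nbr_pair_add_choose_lt (k := k) (by omega) (by omega) hX (hG hAG) (hG hBG) hne
      (by omega)
    have h5 := card_le_of_forall_card_nonMemberSubfamily (V := Icc 1 n) (m := n - 1) hk (by omega)
      (by rw [Nat.card_Icc]; omega) _ F rfl hF hint fun i hi => hgt.le.trans (hdeg_le i hi)
    omega
end

section
/- If n ≥ 2k+2 and k ≥ 1, then every intersecting family F of k-element subsets of [n] satisfies δ_1(F) ≤ C(n−2,k−2); that is, some element of [n] is contained in at most C(n−2,k−2) sets of F. -/
open Finset

section Kneser

variable {α : Type*} [DecidableEq α]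

lemma sum_powersetCard_insert_sub {S : Finset α} {i j : α} (hi : i ∉ S) (hj : j ∉ S) (k : ℕ)
    (v : Finset α → ℝ) :
    ∑ B ∈ (insert j S).powersetCard (k + 1), v B - ∑ B ∈ (insert i S).powersetCard (k + 1), v B =
      -∑ D ∈ S.powersetCard k, (v (insert i D) - v (insert j D)) := by
  have key : ∀ x, x ∉ S → ∑ B ∈ (insert x S).powersetCard (k + 1), v B =
      ∑ B ∈ S.powersetCard (k + 1), v B + ∑ D ∈ S.powersetCard k, v (insert x D) := by
    intro x hx
    rw [powersetCard_succ_insert hx, sum_union, sum_image]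
    · intro A hA B hB hAB
      have hxA : x ∉ A := fun h => hx ((mem_powersetCard.1 hA).1 h)
      have hxB : x ∉ B := fun h => hx ((mem_powersetCard.1 hB).1 h)
      rw [← erase_insert hxA, hAB, erase_insert hxB]
    · rw [disjoint_left]
      intro A hA hA'
      obtain ⟨D, -, rfl⟩ := mem_image.1 hA'
      exact hx ((mem_powersetCard.1 hA).1 (mem_insert_self x D))
  rw [key j hj, key i hi, sum_sub_distrib]
  ring

lemma eq_of_forall_swap_eq {V : Finset α} {k : ℕ} {v : Finset α → ℝ}
    (h : ∀ i ∈ V, ∀ j ∈ V, i ≠ j → ∀ C ∈ (V \ {i, j}).powersetCard k,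
      v (insert i C) = v (insert j C))
    {A B : Finset α} (hA : A ∈ V.powersetCard (k + 1)) (hB : B ∈ V.powersetCard (k + 1)) :
    v A = v B := by
  induction hm : (A \ B).card generalizing A with
  | zero =>
    rw [mem_powersetCard] at hA hB
    have hAB : A ⊆ B := by
      rwa [card_eq_zero, sdiff_eq_empty_iff_subset] at hm
    rw [eq_of_subset_of_card_le hAB (by omega)]
  | succ m ih =>
    have hA' := mem_powersetCard.1 hA
    have hB' := mem_powersetCard.1 hB
    obtain ⟨i, hi⟩ : (A \ B).Nonempty := card_pos.1 (by omega)
    obtain ⟨j, hj⟩ : (B \ A).Nonempty := by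
      rw [← card_pos, card_sdiff_comm (hB'.2.trans hA'.2.symm)]
      omega
    have hi' := mem_sdiff.1 hi
    have hj' := mem_sdiff.1 hj
    have hij : i ≠ j := fun e => hj'.2 (e ▸ hi'.1)
    have hC : A.erase i ∈ (V \ {i, j}).powersetCard k := by
      rw [mem_powersetCard, card_erase_of_mem hi'.1]
      refine ⟨fun x hx => ?_, by omega⟩
      rw [mem_erase] at hx
      have : x ≠ j := fun e => hj'.2 (e ▸ hx.2)
      simp [hx.1, this, hA'.1 hx.2]
    have hjC : j ∉ A.erase i := fun h => hj'.2 (mem_of_mem_erase h)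
    have h1 := h i (hA'.1 hi'.1) j (hB'.1 hj'.1) hij _ hC
    rw [insert_erase hi'.1] at h1
    rw [h1]
    apply ih
    · rw [mem_powersetCard, card_insert_of_notMem hjC, card_erase_of_mem hi'.1]
      refine ⟨insert_subset (hB'.1 hj'.1) ((erase_subset _ _).trans hA'.1), by omega⟩
    · have : insert j (A.erase i) \ B = (A \ B).erase i := by
        ext x
        simp only [mem_sdiff, mem_insert, mem_erase]
        constructor
        · rintro ⟨rfl | h, h'⟩
          · exact absurd hj'.1 h'
          · exact ⟨h.1, h.2, h'⟩
        · rintro ⟨h, h', h''⟩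
          exact ⟨Or.inr ⟨h, h'⟩, h''⟩
      rw [this, card_erase_of_mem hi, hm]
      rfl

/-- Eigenvalues of a Kneser graph are bounded in absolute value by its degree. -/
lemma abs_kneser_eigenvalue_le {V : Finset α} {k : ℕ} {v : Finset α → ℝ} {μ : ℝ}
    (hv : ∀ A ∈ V.powersetCard k, ∑ B ∈ (V \ A).powersetCard k, v B = μ * v A)
    (hne : ∃ A ∈ V.powersetCard k, v A ≠ 0) : |μ| ≤ (V.card - k).choose k := by
  obtain ⟨A₀, hA₀, hvA₀⟩ := hne
  obtain ⟨A, hA, hmax⟩ := exists_max_image (V.powersetCard k) (fun A => |v A|) ⟨A₀, hA₀⟩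
  have hpos : 0 < |v A| := (abs_pos.2 hvA₀).trans_le (hmax A₀ hA₀)
  refine le_of_mul_le_mul_right ?_ hpos
  rw [← abs_mul, ← hv A hA]
  refine (abs_sum_le_sum_abs _ _).trans ?_
  refine (sum_le_card_nsmul _ _ |v A| fun B hB => hmax B ?_).trans ?_
  · exact powersetCard_mono sdiff_subset hB
  · rw [mem_powersetCard] at hA
    rw [card_powersetCard, card_sdiff_of_subset hA.1, hA.2, nsmul_eq_mul]

lemma sdiff_insert_eq_insert {V C : Finset α} {i j : α} (hj : j ∈ V) (hij : i ≠ j)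
    (hC : C ⊆ V \ {i, j}) : V \ insert i C = insert j ((V \ {i, j}) \ C) := by
  have hjC : j ∉ C := fun h => by simpa using hC h
  ext x
  by_cases hx : x = j
  · subst hx; simp [hj, hij.symm, hjC]
  · simp [hx, and_assoc]

/-- The difference operator intertwines a Kneser graph with the negative of a smaller one. -/
lemma kneser_swap_sub {V C : Finset α} {i j : α} (hi : i ∈ V) (hj : j ∈ V) (hij : i ≠ j)
    (hC : C ⊆ V \ {i, j}) (k : ℕ) (v : Finset α → ℝ) :
    ∑ B ∈ (V \ insert i C).powersetCard (k + 1), v B -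
      ∑ B ∈ (V \ insert j C).powersetCard (k + 1), v B =
      -∑ D ∈ ((V \ {i, j}) \ C).powersetCard k, (v (insert i D) - v (insert j D)) := by
  rw [sdiff_insert_eq_insert hj hij hC, sdiff_insert_eq_insert hi hij.symm (pair_comm i j ▸ hC),
    pair_comm j i]
  exact sum_powersetCard_insert_sub (by simp) (by simp) k v

lemma eigenvalue_nonneg_of_sub_kneser {V : Finset α} {k : ℕ} {v : Finset α → ℝ} {a b μ : ℝ}
    (hv : ∀ A ∈ V.powersetCard (k + 1), a * v A + b * ∑ B ∈ V.powersetCard (k + 1), v B -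
      ∑ B ∈ (V \ A).powersetCard (k + 1), v B = μ * v A)
    (hne : ∃ A ∈ V.powersetCard (k + 1), v A ≠ 0)
    (ha : ((V.card - 2 - k).choose k : ℝ) ≤ a)
    (hb : ((V.card - (k + 1)).choose (k + 1) : ℝ) ≤ a + b * V.card.choose (k + 1)) :
    0 ≤ μ := by
  by_cases h : ∀ i ∈ V, ∀ j ∈ V, i ≠ j → ∀ C ∈ (V \ {i, j}).powersetCard k,
      v (insert i C) = v (insert j C)
  · obtain ⟨A, hA, hvA⟩ := hne
    have hc : ∀ B ∈ V.powersetCard (k + 1), v B = v A := fun B hB => eq_of_forall_swap_eq h hB hA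
    have h1 := hv A hA
    rw [sum_congr rfl hc, sum_congr rfl
      (fun B hB => hc B (powersetCard_mono sdiff_subset hB))] at h1
    have hA' := mem_powersetCard.1 hA
    simp only [sum_const, card_powersetCard, card_sdiff_of_subset hA'.1, hA'.2, nsmul_eq_mul] at h1
    have h2 : μ = a + b * V.card.choose (k + 1) - ((V.card - (k + 1)).choose (k + 1) : ℝ) :=
      mul_right_cancel₀ hvA (by rw [← h1]; ring)
    linarith
  · push Not at h
    obtain ⟨i, hi, j, hj, hij, C, hC, hne'⟩ := h
    have hcard : (V \ {i, j}).card = V.card - 2 := by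
      rw [card_sdiff_of_subset (by simp [insert_subset_iff, hi, hj]), card_pair hij]
    have := abs_kneser_eigenvalue_le (V := V \ {i, j}) (k := k)
      (v := fun D => v (insert i D) - v (insert j D)) (μ := μ - a) ?_ ⟨C, hC, sub_ne_zero.2 hne'⟩
    · rw [hcard] at this
      have := (abs_le.1 this).1
      linarith
    · intro D hD
      have hD' := mem_powersetCard.1 hD
      have key := kneser_swap_sub hi hj hij hD'.1 k v
      have e : ∀ x ∈ V, x ∈ ({i, j} : Finset α) → insert x D ∈ V.powersetCard (k + 1) := by
        intro x hx hx'
        rw [mem_powersetCard, card_insert_of_notMem, hD'.2]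
        · exact ⟨insert_subset hx (hD'.1.trans sdiff_subset), rfl⟩
        · exact fun h => (mem_sdiff.1 (hD'.1 h)).2 hx'
      have h1 := hv _ (e i hi (by simp))
      have h2 := hv _ (e j hj (by simp))
      linear_combination h1 - h2 + key

lemma eigenvalue_nonneg_of_kneser {V : Finset α} {k : ℕ} {v : Finset α → ℝ} {a b c μ : ℝ}
    (hv : ∀ A ∈ V.powersetCard (k + 2), ∑ B ∈ (V \ A).powersetCard (k + 2), v B + a * v A -
      b * ∑ i ∈ A, ∑ B ∈ (V \ {i}).powersetCard (k + 2), v B +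
      c * ∑ B ∈ V.powersetCard (k + 2), v B = μ * v A)
    (hne : ∃ A ∈ V.powersetCard (k + 2), v A ≠ 0)
    (ha : ((V.card - 2 - 2 - k).choose k : ℝ) ≤ a)
    (hb : ((V.card - 2 - (k + 1)).choose (k + 1) : ℝ) ≤ a + b * (V.card - 2).choose (k + 1))
    (hc : 0 ≤ ((V.card - (k + 2)).choose (k + 2) : ℝ) + a -
      b * ((k + 2) * (V.card - 1).choose (k + 2)) + c * V.card.choose (k + 2)) :
    0 ≤ μ := by
  by_cases h : ∀ i ∈ V, ∀ j ∈ V, i ≠ j → ∀ C ∈ (V \ {i, j}).powersetCard (k + 1),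
      v (insert i C) = v (insert j C)
  · obtain ⟨A, hA, hvA⟩ := hne
    have hcon : ∀ B ∈ V.powersetCard (k + 2), v B = v A := fun B hB => eq_of_forall_swap_eq h hB hA
    have h1 := hv A hA
    have hA' := mem_powersetCard.1 hA
    have h3 : ∀ i ∈ A, ∑ B ∈ (V \ {i}).powersetCard (k + 2), v B =
        (V.card - 1).choose (k + 2) * v A := by
      intro i hi
      rw [sum_congr rfl (fun B hB => hcon B (powersetCard_mono sdiff_subset hB)), sum_const,
        card_powersetCard, card_sdiff_of_subset (singleton_subset_iff.2 (hA'.1 hi)),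
        card_singleton, nsmul_eq_mul]
    rw [sum_congr rfl hcon, sum_congr rfl h3, sum_congr rfl
      (fun B hB => hcon B (powersetCard_mono sdiff_subset hB))] at h1
    simp only [sum_const, card_powersetCard, card_sdiff_of_subset hA'.1, hA'.2, nsmul_eq_mul] at h1
    push_cast at h1
    have h2 : μ = ((V.card - (k + 2)).choose (k + 2) : ℝ) + a -
      b * ((k + 2) * (V.card - 1).choose (k + 2)) + c * V.card.choose (k + 2) :=
      mul_right_cancel₀ hvA (by rw [← h1]; ring)
    linarith
  · push Not at h
    obtain ⟨i, hi, j, hj, hij, C, hC, hne'⟩ := h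
    have hcard : (V \ {i, j}).card = V.card - 2 := by
      rw [card_sdiff_of_subset (by simp [insert_subset_iff, hi, hj]), card_pair hij]
    refine eigenvalue_nonneg_of_sub_kneser (V := V \ {i, j}) (k := k) (a := a) (b := b)
      (v := fun D => v (insert i D) - v (insert j D)) (μ := μ) ?_ ⟨C, hC, sub_ne_zero.2 hne'⟩
      (by rwa [hcard]) (by rwa [hcard])
    intro D hD
    have hD' := mem_powersetCard.1 hD
    have key := kneser_swap_sub hi hj hij hD'.1 (k + 1) v
    have key2 := kneser_swap_sub hi hj hij (empty_subset _) (k + 1) v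
    simp only [insert_empty_eq, sdiff_empty] at key2
    have e0 : ∀ x ∈ ({i, j} : Finset α), x ∉ D := fun x hx h => (mem_sdiff.1 (hD'.1 h)).2 hx
    have e : ∀ x ∈ V, x ∈ ({i, j} : Finset α) → insert x D ∈ V.powersetCard (k + 2) := by
      intro x hx hx'
      rw [mem_powersetCard, card_insert_of_notMem (e0 x hx'), hD'.2]
      exact ⟨insert_subset hx (hD'.1.trans sdiff_subset), rfl⟩
    have h1 := hv _ (e i hi (by simp))
    have h2 := hv _ (e j hj (by simp))
    rw [sum_insert (e0 _ (by simp))] at h1 h2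
    linear_combination h1 - h2 - key + b * key2

/-- The entries of a matrix on `k`-sets which is a combination of the identity, a Kneser graph,
the all-ones matrix and the matrix of the sizes of set differences. -/
def kneserEntry (a b c : ℝ) (A B : Finset α) : ℝ :=
  (if Disjoint B A then 1 else 0) + (if B = A then a else 0) - b * (A \ B).card + c

lemma powersetCard_sdiff_eq_filter (V A : Finset α) (k : ℕ) :
    (V \ A).powersetCard k = (V.powersetCard k).filter (fun B => Disjoint B A) := by
  ext B
  simp only [mem_powersetCard, mem_filter, subset_sdiff]
  tauto

lemma sum_kneserEntry_mul {V A : Finset α} {k : ℕ} (hA : A ∈ V.powersetCard k) (a b c : ℝ)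
    (v : Finset α → ℝ) :
    ∑ B ∈ V.powersetCard k, kneserEntry a b c A B * v B =
      ∑ B ∈ (V \ A).powersetCard k, v B + a * v A -
      b * ∑ i ∈ A, ∑ B ∈ (V \ {i}).powersetCard k, v B +
      c * ∑ B ∈ V.powersetCard k, v B := by
  have h1 : ∑ i ∈ A, ∑ B ∈ (V \ {i}).powersetCard k, v B =
      ∑ B ∈ V.powersetCard k, ((A \ B).card : ℝ) * v B := by
    simp_rw [powersetCard_sdiff_eq_filter, sum_filter]
    rw [sum_comm]
    refine sum_congr rfl fun B _ => ?_
    simp only [disjoint_singleton_right]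
    rw [← sum_filter, sum_const, nsmul_eq_mul, sdiff_eq_filter]
  rw [h1, powersetCard_sdiff_eq_filter, sum_filter, mul_sum, mul_sum]
  have h2 : a * v A = ∑ B ∈ V.powersetCard k, if B = A then a * v B else 0 := by
    rw [sum_ite_eq' , if_pos hA]
  rw [h2, ← sum_add_distrib, ← sum_sub_distrib, ← sum_add_distrib]
  refine sum_congr rfl fun B _ => ?_
  unfold kneserEntry
  split_ifs <;> ring

lemma kneser_quadratic_form_nonneg {V : Finset α} {k : ℕ} {a b c : ℝ} (f : Finset α → ℝ)
    (ha : ((V.card - 2 - 2 - k).choose k : ℝ) ≤ a)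
    (hb : ((V.card - 2 - (k + 1)).choose (k + 1) : ℝ) ≤ a + b * (V.card - 2).choose (k + 1))
    (hc : 0 ≤ ((V.card - (k + 2)).choose (k + 2) : ℝ) + a -
      b * ((k + 2) * (V.card - 1).choose (k + 2)) + c * V.card.choose (k + 2)) :
    0 ≤ ∑ A ∈ V.powersetCard (k + 2), f A * (∑ B ∈ (V \ A).powersetCard (k + 2), f B + a * f A -
      b * ∑ i ∈ A, ∑ B ∈ (V \ {i}).powersetCard (k + 2), f B +
      c * ∑ B ∈ V.powersetCard (k + 2), f B) := by
  let M : Matrix (V.powersetCard (k + 2)) (V.powersetCard (k + 2)) ℝ :=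
    Matrix.of fun A B => kneserEntry a b c A.1 B.1
  have hmul : ∀ (v : Finset α → ℝ) (A : V.powersetCard (k + 2)),
      M.mulVec (fun B => v B) A = ∑ B ∈ (V \ A).powersetCard (k + 2), v B + a * v A -
        b * ∑ i ∈ A.1, ∑ B ∈ (V \ {i}).powersetCard (k + 2), v B +
        c * ∑ B ∈ V.powersetCard (k + 2), v B := by
    intro v A
    rw [← sum_kneserEntry_mul A.2]
    exact sum_coe_sort (V.powersetCard (k + 2)) (fun B => kneserEntry a b c A B * v B)
  have hM : M.IsHermitian := by
    ext A B
    have hcard : (A.1 \ B.1).card = (B.1 \ A.1).card :=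
      card_sdiff_comm ((mem_powersetCard.1 A.2).2.trans (mem_powersetCard.1 B.2).2.symm)
    simp [M, kneserEntry, hcard, disjoint_comm, eq_comm]
  have hpsd : M.PosSemidef := by
    rw [hM.posSemidef_iff_eigenvalues_nonneg]
    intro j
    let x := hM.eigenvectorBasis j
    let v : Finset α → ℝ := fun A => if h : A ∈ V.powersetCard (k + 2) then x ⟨A, h⟩ else 0
    have hv : ∀ A : V.powersetCard (k + 2), v A = x A := fun A => by simp only [v, dif_pos A.2]
    have hvx : (fun B : V.powersetCard (k + 2) => v B) = ⇑x := funext hv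
    refine eigenvalue_nonneg_of_kneser (v := v) (fun A hA => ?_) ?_ ha hb hc
    · rw [← hmul v ⟨A, hA⟩, hvx, hM.mulVec_eigenvectorBasis j, hv ⟨A, hA⟩]
      rfl
    · by_contra! h
      apply hM.eigenvectorBasis.orthonormal.ne_zero j
      ext A
      exact (hv A).symm.trans (h A A.2)
  have := hpsd.dotProduct_mulVec_nonneg (fun A => f A)
  refine this.trans_eq ?_
  rw [← sum_coe_sort]
  refine sum_congr rfl fun A _ => ?_
  rw [hmul]
  rfl

/-- The spectral inequality for the degree sequence of an intersecting family. -/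
lemma intersecting_degree_inequality {V : Finset α} {k : ℕ} {a b c : ℝ} {F : Finset (Finset α)}
    (hF : F ⊆ V.powersetCard (k + 2)) (hint : ∀ A ∈ F, ∀ B ∈ F, ¬ Disjoint A B)
    (ha : ((V.card - 2 - 2 - k).choose k : ℝ) ≤ a)
    (hb : ((V.card - 2 - (k + 1)).choose (k + 1) : ℝ) ≤ a + b * (V.card - 2).choose (k + 1))
    (hc : 0 ≤ ((V.card - (k + 2)).choose (k + 2) : ℝ) + a -
      b * ((k + 2) * (V.card - 1).choose (k + 2)) + c * V.card.choose (k + 2)) :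
    0 ≤ a * F.card - b * ∑ i ∈ V, ((F.filter (i ∈ ·)).card : ℝ) *
      (F.card - (F.filter (i ∈ ·)).card) + c * (F.card : ℝ) ^ 2 := by
  have h := kneser_quadratic_form_nonneg (fun A => if A ∈ F then (1 : ℝ) else 0) ha hb hc
  refine h.trans_eq ?_
  have hfil : (V.powersetCard (k + 2)).filter (· ∈ F) = F := by
    rw [filter_mem_eq_inter, inter_eq_right.2 hF]
  have h0 : ∑ B ∈ V.powersetCard (k + 2), (if B ∈ F then (1 : ℝ) else 0) = F.card := by
    rw [← sum_filter, hfil]; simp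
  have h1 : ∀ i, ∑ B ∈ (V \ {i}).powersetCard (k + 2), (if B ∈ F then (1 : ℝ) else 0) =
      F.card - (F.filter (i ∈ ·)).card := by
    intro i
    rw [powersetCard_sdiff_eq_filter, sum_filter, ← card_filter_add_card_filter_not (s := F) (i ∈ ·)]
    simp only [disjoint_singleton_right]
    rw [← sum_filter, ← sum_filter, filter_comm, hfil]
    simp
  have h2 : ∀ A ∈ F, ∑ B ∈ (V \ A).powersetCard (k + 2), (if B ∈ F then (1 : ℝ) else 0) = 0 := by
    intro A hA
    rw [powersetCard_sdiff_eq_filter]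
    refine sum_eq_zero fun B hB => if_neg fun hBF => ?_
    exact hint B hBF A hA (mem_filter.1 hB).2
  have h3 : ∑ A ∈ F, ∑ i ∈ A, ((F.card : ℝ) - (F.filter (i ∈ ·)).card) =
      ∑ i ∈ V, ((F.filter (i ∈ ·)).card : ℝ) * (F.card - (F.filter (i ∈ ·)).card) := by
    have : ∀ A ∈ F, ∑ i ∈ A, ((F.card : ℝ) - (F.filter (i ∈ ·)).card) =
        ∑ i ∈ V, if i ∈ A then ((F.card : ℝ) - (F.filter (i ∈ ·)).card) else 0 := by
      intro A hA
      rw [← sum_filter, filter_mem_eq_inter, inter_eq_right.2 (mem_powersetCard.1 (hF hA)).1]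
    rw [sum_congr rfl this, sum_comm]
    refine sum_congr rfl fun i _ => ?_
    rw [← sum_filter, sum_const, nsmul_eq_mul]
  simp only [ite_mul, one_mul, zero_mul, h0, h1]
  rw [← sum_filter, hfil, ← h3, mul_sum]
  have h4 : ∀ A ∈ F, (∑ B ∈ (V \ A).powersetCard (k + 2), (if B ∈ F then (1 : ℝ) else 0) +
      a * (if A ∈ F then 1 else 0) - b * ∑ i ∈ A, ((F.card : ℝ) - (F.filter (i ∈ ·)).card) +
      c * F.card) = a - b * ∑ i ∈ A, ((F.card : ℝ) - (F.filter (i ∈ ·)).card) + c * F.card := by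
    intro A hA
    rw [h2 A hA, if_pos hA]
    ring
  rw [sum_congr rfl h4, sum_add_distrib, sum_sub_distrib]
  simp only [sum_const, nsmul_eq_mul]
  ring

end Kneser

lemma card_le_choose_of_intersecting {n k : ℕ} (hn : 2 * k ≤ n) {F : Finset (Finset ℕ)}
    (hF : F ⊆ (Icc 1 n).powersetCard k) (hint : ∀ A ∈ F, ∀ B ∈ F, ¬ Disjoint A B) :
    F.card ≤ (n - 1).choose (k - 1) := by
  let e : Fin n ↪ ℕ := ⟨fun i => i + 1, fun i j h => Fin.ext (by simpa using h)⟩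
  have hmap : ∀ A ∈ F, (univ.filter (fun i : Fin n => e i ∈ A)).map e = A := by
    intro A hA
    ext x
    simp only [mem_map, mem_filter, mem_univ, true_and]
    constructor
    · rintro ⟨i, hi, rfl⟩
      exact hi
    · intro hx
      have := mem_Icc.1 ((mem_powersetCard.1 (hF hA)).1 hx)
      have hex : e ⟨x - 1, by omega⟩ = x := Nat.sub_add_cancel this.1
      exact ⟨⟨x - 1, by omega⟩, by rwa [hex], hex⟩
  rw [← card_image_of_injOn (s := F) (f := fun A => univ.filter (fun i : Fin n => e i ∈ A))
    fun A hA B hB hAB => by rw [← hmap A hA, ← hmap B hB]; exact congrArg (map e) hAB]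
  apply erdos_ko_rado
  · intro A hA B hB hAB
    obtain ⟨A', hA', rfl⟩ := mem_image.1 hA
    obtain ⟨B', hB', rfl⟩ := mem_image.1 hB
    apply hint A' hA' B' hB'
    rw [← hmap A' hA', ← hmap B' hB']
    exact (disjoint_map e).2 hAB
  · intro A hA
    obtain ⟨A', hA', rfl⟩ := mem_image.1 hA
    rw [← card_map e, hmap A' hA', (mem_powersetCard.1 (hF hA')).2]
  · omega

lemma sum_card_filter_mem {V : Finset ℕ} {k : ℕ} {F : Finset (Finset ℕ)}
    (hF : F ⊆ V.powersetCard k) : ∑ i ∈ V, (F.filter (i ∈ ·)).card = k * F.card := by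
  simp_rw [card_filter]
  rw [sum_comm, sum_const_nat (m := k), mul_comm]
  intro A hA
  have := mem_powersetCard.1 (hF hA)
  rw [← card_filter, filter_mem_eq_inter, inter_eq_right.2 this.1, this.2]

/-- The coefficients for which the spectral inequality is tight on a star. -/
lemma intersecting_degree_inequality_star {q k : ℕ} {F : Finset (Finset ℕ)}
    (hF : F ⊆ (Icc 1 (q + k + 4)).powersetCard (k + 2))
    (hint : ∀ A ∈ F, ∀ B ∈ F, ¬ Disjoint A B) (hq : k ≤ q) :
    ((q : ℝ) - k) * (q + k + 3) * ∑ i ∈ Icc 1 (q + k + 4), ((F.filter (i ∈ ·)).card : ℝ) *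
      (F.card - (F.filter (i ∈ ·)).card) ≤ (k + 1) * (q + 2) *
        ((q + k + 3).choose (k + 1) * F.card + (q - k - 1) * (F.card : ℝ) ^ 2) := by
  have hTn : 0 < q.choose k := Nat.choose_pos hq
  have hMn : 0 < (q + k + 3).choose (k + 1) := Nat.choose_pos (by omega)
  have hT : (0 : ℝ) < q.choose k := by exact_mod_cast hTn
  have hM : (0 : ℝ) < (q + k + 3).choose (k + 1) := by exact_mod_cast hMn
  have e1 : ((q : ℝ) + 1) * q.choose k = (q + 1).choose (k + 1) * (k + 1) := by
    exact_mod_cast Nat.add_one_mul_choose_eq q k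
  have e2 : ((q : ℝ) + 2) * (q + 1).choose (k + 1) = (q + 2).choose (k + 2) * (k + 2) := by
    exact_mod_cast Nat.add_one_mul_choose_eq (q + 1) (k + 1)
  have e3 : ((q : ℝ) + k + 4) * (q + k + 3).choose (k + 1) =
      (q + k + 4).choose (k + 2) * (k + 2) := by
    exact_mod_cast Nat.add_one_mul_choose_eq (q + k + 3) (k + 1)
  have e4 : ((q + k + 3).choose (k + 2) : ℝ) * (k + 2) = (q + k + 3).choose (k + 1) * (q + 2) := by
    have := Nat.choose_succ_right_eq (q + k + 3) (k + 1)
    rw [show q + k + 3 - (k + 1) = q + 2 by omega] at this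
    exact_mod_cast this
  have e5 : ((q + k + 2).choose (k + 1) : ℝ) * (q + k + 3) = (q + k + 3).choose (k + 1) * (q + 2) := by
    have := Nat.choose_mul_succ_eq (q + k + 2) (k + 1)
    rw [show q + k + 2 + 1 - (k + 1) = q + 2 by omega] at this
    exact_mod_cast this
  set T : ℝ := (q.choose k : ℝ)
  set M : ℝ := ((q + k + 3).choose (k + 1) : ℝ)
  have hk1 : (0 : ℝ) < k + 1 := by positivity
  have hk2 : (0 : ℝ) < k + 2 := by positivity
  have hq2 : (0 : ℝ) < q + 2 := by positivity
  have hn3 : (0 : ℝ) < q + k + 3 := by positivity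
  have E1 : ((q + 1).choose (k + 1) : ℝ) = (q + 1) * T / (k + 1) := by
    rw [eq_div_iff hk1.ne']; exact e1.symm
  have E2 : ((q + 2).choose (k + 2) : ℝ) = (q + 2) * ((q + 1) * T / (k + 1)) / (k + 2) := by
    rw [eq_div_iff hk2.ne', ← E1]; exact e2.symm
  have E3 : ((q + k + 4).choose (k + 2) : ℝ) = (q + k + 4) * M / (k + 2) := by
    rw [eq_div_iff hk2.ne']; exact e3.symm
  have E4 : ((q + k + 3).choose (k + 2) : ℝ) = M * (q + 2) / (k + 2) := by
    rw [eq_div_iff hk2.ne']; exact e4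
  have E5 : ((q + k + 2).choose (k + 1) : ℝ) = M * (q + 2) / (q + k + 3) := by
    rw [eq_div_iff hn3.ne']; exact e5
  have h := intersecting_degree_inequality hF hint (a := T)
    (b := T * (q - k) * (q + k + 3) / ((k + 1) * (q + 2) * M)) (c := T * (q - k - 1) / M)
    (by rw [Nat.card_Icc, show q + k + 4 + 1 - 1 - 2 - 2 - k = q by omega])
    (by
      rw [Nat.card_Icc, show q + k + 4 + 1 - 1 - 2 - (k + 1) = q + 1 by omega,
        show q + k + 4 + 1 - 1 - 2 = q + k + 2 by omega, E1, E5]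
      apply le_of_eq
      field_simp
      ring)
    (by
      rw [Nat.card_Icc, show q + k + 4 + 1 - 1 - (k + 2) = q + 2 by omega,
        show q + k + 4 + 1 - 1 - 1 = q + k + 3 by omega,
        show q + k + 4 + 1 - 1 = q + k + 4 by omega, E2, E3, E4]
      apply le_of_eq
      field_simp
      ring)
  set S := ∑ i ∈ Icc 1 (q + k + 4), ((F.filter (i ∈ ·)).card : ℝ) *
      (F.card - (F.filter (i ∈ ·)).card)
  have h' := mul_nonneg (show 0 ≤ (k + 1) * (q + 2) * M / T by positivity) h
  have h2 : (k + 1) * (q + 2) * M / T * (T * F.card -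
      T * (q - k) * (q + k + 3) / ((k + 1) * (q + 2) * M) * S +
      T * (q - k - 1) / M * (F.card : ℝ) ^ 2) = (k + 1) * (q + 2) *
        (M * F.card + (q - k - 1) * (F.card : ℝ) ^ 2) - (q - k) * (q + k + 3) * S := by
    field_simp
    ring
  linarith

lemma exists_card_filter_mem_le {q k : ℕ} {F : Finset (Finset ℕ)}
    (hF : F ⊆ (Icc 1 (q + k + 4)).powersetCard (k + 2))
    (hint : ∀ A ∈ F, ∀ B ∈ F, ¬ Disjoint A B) (hq : k + 1 ≤ q) :
    ∃ i ∈ Icc 1 (q + k + 4), (F.filter (i ∈ ·)).card ≤ (q + k + 2).choose k := by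
  by_contra! hlt
  have hdeg := intersecting_degree_inequality_star hF hint (by omega)
  have hekr : (F.card : ℝ) ≤ (q + k + 3).choose (k + 1) := by
    exact_mod_cast card_le_choose_of_intersecting (by omega) hF hint
  have hsum : ∑ i ∈ Icc 1 (q + k + 4), ((F.filter (i ∈ ·)).card : ℝ) = (k + 2) * F.card := by
    exact_mod_cast sum_card_filter_mem hF
  have hpos : (0 : ℝ) < F.card := by
    have h1 := hlt 1 (by simp)
    have h2 := card_filter_le F (1 ∈ ·)
    exact_mod_cast (show 0 < F.card by omega)
  have e : ((q : ℝ) + k + 3) * (q + k + 2).choose k = (q + k + 3).choose (k + 1) * (k + 1) := by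
    exact_mod_cast Nat.add_one_mul_choose_eq (q + k + 2) k
  set m : ℝ := (F.card : ℝ)
  set M : ℝ := ((q + k + 3).choose (k + 1) : ℝ)
  set d : ℝ := ((q + k + 2).choose k : ℝ)
  have hS : (d + 1) * (m * (q + 2)) ≤ ∑ i ∈ Icc 1 (q + k + 4), ((F.filter (i ∈ ·)).card : ℝ) *
      (m - (F.filter (i ∈ ·)).card) := by
    have h1 : ∑ i ∈ Icc 1 (q + k + 4), (d + 1) * (m - (F.filter (i ∈ ·)).card) =
        (d + 1) * (m * (q + 2)) := by
      rw [← mul_sum, sum_sub_distrib, hsum, sum_const, Nat.card_Icc, nsmul_eq_mul]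
      push_cast [show q + k + 4 + 1 - 1 = q + k + 4 by omega]
      ring
    rw [← h1]
    refine sum_le_sum fun i hi => mul_le_mul_of_nonneg_right ?_ (sub_nonneg.2 ?_)
    · exact (Nat.cast_add_one _).symm.trans_le (Nat.cast_le.2 (hlt i hi))
    · exact Nat.cast_le.2 (card_filter_le F (i ∈ ·))
  have hqk : (0 : ℝ) ≤ q - k - 1 := by
    have : ((k + 1 : ℕ) : ℝ) ≤ q := by exact_mod_cast hq
    push_cast at this
    linarith
  have h1 : ((q : ℝ) - k) * (q + k + 3) * ((d + 1) * (m * (q + 2))) ≤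
      (k + 1) * (q + 2) * (M * m + (q - k - 1) * m ^ 2) :=
    (mul_le_mul_of_nonneg_left hS
      (mul_nonneg (by linarith : (0 : ℝ) ≤ q - k) (by positivity))).trans hdeg
  have h2 : (k + 1) * (q + 2) * (M * m + (q - k - 1) * m ^ 2) ≤
      (k + 1) * (q + 2) * (M * m + (q - k - 1) * (M * m)) := by
    gcongr
    nlinarith
  have h3 : (0 : ℝ) < (q - k) * (q + k + 3) * (m * (q + 2)) := by
    have : (0 : ℝ) < q - k := by linarith
    positivity
  have h4 : (q - k) * (m * (q + 2)) * ((q + k + 3) * d) =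
      (q - k) * (m * (q + 2)) * (M * (k + 1)) := by rw [e]
  linarith

/-- the degree version of the Erdős–Ko–Rado theorem for `n ≥ 2k+2`. -/
theorem statement14 (n k : ℕ) (hk : 1 ≤ k) (hn : 2 * k + 2 ≤ n)
    (F : Finset (Finset ℕ)) (hF : F ⊆ (Finset.Icc 1 n).powersetCard k)
    (hint : IntersectingFam F) :
    ∃ i ∈ Finset.Icc 1 n, famDeg F i ≤ Nat.choose (n - 2) (k - 2) := by
  have hint' : ∀ A ∈ F, ∀ B ∈ F, ¬ Disjoint A B := fun A hA B hB =>
    not_disjoint_iff_nonempty_inter.2 (hint A hA B hB)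
  obtain rfl | ⟨j, rfl⟩ : k = 1 ∨ ∃ j, k = j + 2 := by
    obtain _ | _ | j := k
    · omega
    · exact Or.inl rfl
    · exact Or.inr ⟨j, rfl⟩
  · refine ⟨1, by simp; omega, (card_filter_le _ _).trans ?_⟩
    simpa using card_le_choose_of_intersecting (by omega) hF hint'
  · obtain ⟨q, rfl⟩ : ∃ q, n = q + j + 4 := ⟨n - j - 4, by omega⟩
    exact exists_card_filter_mem_le hF hint' (by omega)
end
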